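/- Let 1 ≤ d ≤ 3, let Ω ⊂ ℝ^{n-d} be a bounded domain, and consider the compressible Navier–Stokes system without horizontal viscosity on ℝ^d × Ω with pressure p(ρ) = ρ²/2 and viscosity constants λ, μ: ∂_t ρ + ∇_y·(ρv) + ∇_z·(ρw) = 0, ∂_t(ρv) + ∇_y·(ρ v⊗v) + ∇_z·(ρ v⊗w) + ∇_y p(ρ) = 0, ∂_t(ρw) + ∇_z·(ρ w⊗w) + ∇_y·(ρ w⊗v) + ∇_z p(ρ) = λ Δ_z w + μ ∇_z(∇_z·w), where y ∈ ℝ^d, z ∈ Ω, v ∈ ℝ^d, w ∈ ℝ^{n-d}. Let (ρ, v, w) be a classical solution on [0,T) with initial data ρ = 1+ρ₀, v = v₀, w = w₀ smooth with ρ₀, v₀, w₀ supported in {|y| ≤ 1}, with Dirichlet boundary condition w(t,y,z) = 0 for z ∈ ∂Ω, and suppose that for each t, ρ(t,·)−1, v(t,·), w(t,·) are supported in {|y| ≤ 1+t}. If ∫_Ω ∫_{ℝ^d} ∫_{S^{d-1}} e^{ω·y} ρ₀(y,z) dσ(ω) dy dz + ∫_Ω ∫_{ℝ^d} ∫_{S^{d-1}}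 e^{ω·y} (1+ρ₀(y,z)) (v₀(y,z)·ω) dσ(ω) dy dz > 0, then T < ∞ (for d = 1 one replaces ∫_{S^{d-1}} e^{ω·y} dσ(ω) by e^y + e^{-y} and v₀·ω by v₀). -/

import Mathlib

open MeasureTheory Real Set Metric
open scoped ENNReal RealInnerProductSpace

noncomputable section

/-- Euclidean space `ℝᵏ`. -/
abbrev Euc (k : ℕ) : Type := EuclideanSpace ℝ (Fin k)

/-- The surface measure on the unit sphere `S^{d-1} ⊆ ℝᵈ`.  (For `d = 1` this is the
counting-type measure on `S⁰ = {−1, 1}`, so that `∫_{S⁰} e^{ω·y} dσ(ω) = e^y + e^{-y}`.) -/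
def sphμ (d : ℕ) : Measure (sphere (0 : Euc d) 1) := (volume : Measure (Euc d)).toSphere

/-- The partial derivative `∂ᵢ f` on `ℝᵏ`. -/
def pdv {k : ℕ} (i : Fin k) (f : Euc k → ℝ) (x : Euc k) : ℝ :=
  fderiv ℝ f x (EuclideanSpace.single i 1)

/-- The time interval `[0, T)` for an extended-real final time `T ∈ (0, ∞]`. -/
def timeSet (T : ℝ≥0∞) : Set ℝ := {t : ℝ | 0 ≤ t ∧ ENNReal.ofReal t < T}

open scoped Topology

lemma ode_mono {f f' : ℝ → ℝ} {a : ℝ} (hc : ContinuousOn f (Ici a))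
    (hd : ∀ t, a < t → HasDerivAt f (f' t) t) (h0 : ∀ t, a < t → 0 ≤ f' t) :
    MonotoneOn f (Ici a) := by
  refine monotoneOn_of_deriv_nonneg (convex_Ici a) hc ?_ ?_
  · rw [interior_Ici]; intro t ht; exact (hd t ht).differentiableAt.differentiableWithinAt
  · rw [interior_Ici]; intro t ht; rw [(hd t ht).deriv]; exact h0 t ht

lemma ode_blowup {f g h : ℝ → ℝ} {κ : ℝ} (hκ : 0 < κ)
    (hfc : ContinuousOn f (Ici 0)) (hgc : ContinuousOn g (Ici 0))
    (hf : ∀ t, 0 < t → HasDerivAt f (g t) t) (hg : ∀ t, 0 < t → HasDerivAt g (h t) t)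
    (hh : ∀ t, 0 < t → -2 * g t + κ * f t ^ 2 / (1 + t) ≤ h t)
    (h0 : 0 < g 0 + 2 * f 0) : False := by
  set c := g 0 + 2 * f 0 with hc
  have hP : ∀ t, 0 ≤ t → c ≤ g t + 2 * f t := by
    intro t ht
    have := ode_mono (f := fun t => g t + 2 * f t) (f' := fun t => h t + 2 * g t) (a := 0)
      (by fun_prop) (fun t ht => (hg t ht).add ((hf t ht).const_mul 2))
      (fun t ht => by
        have := hh t ht
        have h2 : 0 ≤ κ * f t ^ 2 / (1 + t) := by positivity
        linarith)
    exact this (mem_Ici.2 le_rfl) ht ht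
  have hexp : ∀ t : ℝ, HasDerivAt (fun t => exp (2 * t)) (exp (2 * t) * 2) t := by
    intro t
    have := ((hasDerivAt_id t).const_mul 2).exp
    simpa using this
  have hf2 : ∀ t, 0 ≤ t → (f 0 - c / 2) ≤ (f t - c / 2) * exp (2 * t) := by
    intro t ht
    have := ode_mono (f := fun t => (f t - c / 2) * exp (2 * t))
      (f' := fun t => g t * exp (2 * t) + (f t - c / 2) * (exp (2 * t) * 2)) (a := 0)
      (by fun_prop) (fun t ht => ((hf t ht).sub_const _).mul (hexp t))
      (fun t ht => by
        have := hP t ht.le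
        have h2 := exp_pos (2 * t)
        nlinarith)
    simpa using this (mem_Ici.2 le_rfl) ht ht
  have hf1 : ∃ t1, 0 < t1 ∧ ∀ t, t1 ≤ t → c / 4 ≤ f t := by
    refine ⟨4 * |f 0 - c / 2| / c + 1, by positivity, fun t ht => ?_⟩
    have ht0 : 0 ≤ t := le_trans (by positivity) ht
    have h1 := hf2 t ht0
    have h2 := add_one_le_exp (2 * t)
    by_contra hlt
    push Not at hlt
    have h3 : 4 * |f 0 - c / 2| / c ≤ t := by linarith
    rw [div_le_iff₀ h0] at h3
    have h4 := neg_abs_le (f 0 - c / 2)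
    have h5 : (f t - c / 2) * exp (2 * t) ≤ (- c / 4) * exp (2 * t) := by
      apply mul_le_mul_of_nonneg_right _ (exp_pos _).le
      linarith
    nlinarith [abs_nonneg (f 0 - c / 2)]
  obtain ⟨t1, ht1, hf1⟩ := hf1
  have hg2 : ∃ t2, t1 ≤ t2 ∧ 0 < g t2 := by
    set k := κ * (c / 4) ^ 2 with hk
    have hkpos : 0 < k := by positivity
    have hm := ode_mono (f := fun t => g t * exp (2 * t) - k * t)
      (f' := fun t => h t * exp (2 * t) + g t * (exp (2 * t) * 2) - k * 1) (a := t1)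
      ((hgc.mono (Ici_subset_Ici.2 ht1.le)).mul (by fun_prop) |>.sub (by fun_prop))
      (fun t ht => ((hg t (ht1.trans ht)).mul (hexp t)).sub ((hasDerivAt_id t).const_mul k))
      (fun t ht => by
        have htp := ht1.trans ht
        have h1 := hh t htp
        have h2 := add_one_le_exp (2 * t)
        have h3 : k / (1 + t) ≤ κ * f t ^ 2 / (1 + t) := by
          gcongr
          rw [hk]; gcongr; exact hf1 t ht.le
        have h4 : k ≤ (k / (1 + t)) * exp (2 * t) := by
          rw [div_mul_eq_mul_div, le_div_iff₀ (by linarith)]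
          gcongr; linarith
        have h5 : (k / (1 + t)) * exp (2 * t) ≤ (h t + 2 * g t) * exp (2 * t) := by
          gcongr; linarith
        linarith)
    set t2 := t1 + (|g t1 * exp (2 * t1)| + 1) / k with ht2
    have h12 : t1 ≤ t2 := by rw [ht2]; linarith [show 0 ≤ (|g t1 * exp (2 * t1)| + 1) / k by positivity]
    refine ⟨t2, h12, ?_⟩
    have h1 := hm (mem_Ici.2 le_rfl) h12 h12
    simp only at h1
    have h2 : k * t2 = k * t1 + (|g t1 * exp (2 * t1)| + 1) := by
      rw [ht2]; field_simp
    have h3 := neg_abs_le (g t1 * exp (2 * t1))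
    have h4 : 0 < g t2 * exp (2 * t2) := by linarith
    exact pos_of_mul_pos_left h4 (exp_pos _).le
  obtain ⟨t2, ht12, hg2⟩ := hg2
  have ht2 : 0 < t2 := ht1.trans_le ht12
  have hfpos : ∀ t, t2 ≤ t → 0 < f t := fun t ht =>
    lt_of_lt_of_le (by positivity) (hf1 t (ht12.trans ht))
  set s0 := √(c / 4) with hs0
  have hs0pos : 0 < s0 := Real.sqrt_pos.2 (by positivity)
  have hs : ∀ t, t2 ≤ t → s0 ≤ √(f t) := fun t ht => Real.sqrt_le_sqrt (hf1 t (ht12.trans ht))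
  have hf2pos := hfpos t2 le_rfl
  obtain ⟨ε, hε, hε1, hε2, hε3, hε4⟩ : ∃ ε : ℝ, 0 < ε ∧ ε ≤ 1 ∧ 8 * ε ≤ κ * s0 ∧ 8 * ε ≤ κ ∧
      ε * (f t2 * √(f t2)) ≤ g t2 := by
    have hq : 0 < f t2 * √(f t2) := mul_pos hf2pos (Real.sqrt_pos.2 hf2pos)
    refine ⟨min (min 1 (κ * s0 / 8)) (min (κ / 8) (g t2 / (f t2 * √(f t2)))), by positivity,
      (min_le_left _ _).trans (min_le_left _ _), ?_, ?_, ?_⟩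
    · have := (min_le_left (min 1 (κ * s0 / 8)) (min (κ / 8) (g t2 / (f t2 * √(f t2))))).trans (min_le_right _ _)
      linarith
    · have := (min_le_right (min 1 (κ * s0 / 8)) (min (κ / 8) (g t2 / (f t2 * √(f t2))))).trans (min_le_left _ _)
      linarith
    · have := (min_le_right (min 1 (κ * s0 / 8)) (min (κ / 8) (g t2 / (f t2 * √(f t2))))).trans (min_le_right _ _)
      rwa [le_div_iff₀ hq] at this
  have hτ : ∀ t, t2 ≤ t → HasDerivAt (fun t : ℝ => (1 + t)⁻¹) (-1 / (1 + t) ^ 2) t := fun t ht => by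
    have := ((hasDerivAt_id t).const_add 1).inv (by simp only [id]; linarith)
    exact this
  have hsq : ∀ t, t2 ≤ t → HasDerivAt (fun t => √(f t)) (g t / (2 * √(f t))) t := fun t ht =>
    (hf t (ht2.trans_le ht)).sqrt (hfpos t ht).ne'
  have hbar : ∀ t, t2 ≤ t → ε * (1 + t)⁻¹ * (f t * √(f t)) ≤ g t := by
    intro b hb
    have hD : ∀ t, t2 ≤ t → HasDerivAt (fun t => ε * (1 + t)⁻¹ * (f t * √(f t)) - g t)
        (ε * (-1 / (1 + t) ^ 2) * (f t * √(f t)) +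
          ε * (1 + t)⁻¹ * (g t * √(f t) + f t * (g t / (2 * √(f t)))) - h t) t := fun t ht =>
      (((hτ t ht).const_mul ε).mul ((hf t (ht2.trans_le ht)).mul (hsq t ht))).sub
        (hg t (ht2.trans_le ht))
    have := image_le_of_deriv_right_lt_deriv_boundary (a := t2) (b := b)
      (f := fun t => ε * (1 + t)⁻¹ * (f t * √(f t)) - g t) (B := fun _ => 0) (B' := fun _ => 0)
      (fun t ht => (hD t ht.1).continuousAt.continuousWithinAt)
      (fun t ht => (hD t ht.1).hasDerivWithinAt) ?_ (fun x => hasDerivAt_const _ _) ?_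
      (right_mem_Icc.2 hb)
    · simpa using this
    · simp only [tsub_le_iff_right, zero_add]
      refine le_trans ?_ hε4
      have : (1 + t2)⁻¹ ≤ 1 := inv_le_one_of_one_le₀ (by linarith)
      have hq : 0 < f t2 * √(f t2) := mul_pos hf2pos (Real.sqrt_pos.2 hf2pos)
      nlinarith [mul_pos hε hq]
    · intro t ht he
      have ht0 := ht2.trans_le ht.1
      have hft := hfpos t ht.1
      have hst := hs t ht.1
      have h1 := hh t ht0
      set s := √(f t) with hsd
      have hss : f t = s ^ 2 := (Real.sq_sqrt hft.le).symm
      have hspos : 0 < s := hs0pos.trans_le hst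
      have hge : g t = ε * (1 + t)⁻¹ * (f t * s) := by linarith
      rw [div_eq_mul_inv] at h1
      set τ := (1 + t)⁻¹ with hτd
      have hτp : 0 < τ := by positivity
      have hτ1 : τ ≤ 1 := inv_le_one_of_one_le₀ (by linarith)
      have e1 : g t * s + f t * (g t / (2 * s)) = 3 / 2 * ε * τ * s ^ 4 := by
        rw [hge, hss]; field_simp; ring
      rw [e1]
      rw [hge, hss] at h1
      have e2 : ε * (-1 / (1 + t) ^ 2) * (f t * s) ≤ 0 := by
        have : 0 ≤ ε * (1 / (1 + t) ^ 2) * (f t * s) := by positivity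
        have e3 : ε * (-1 / (1 + t) ^ 2) * (f t * s) = - (ε * (1 / (1 + t) ^ 2) * (f t * s)) := by ring
        linarith
      have e4 : ε * τ * (3 / 2 * ε * τ * s ^ 4) ≤ τ * s ^ 4 * (3 / 2 * ε) := by
        have : ε * τ ≤ 1 := by nlinarith
        have h6 : 0 ≤ τ * s ^ 4 * (3 / 2 * ε) := by positivity
        nlinarith
      have e5 : 2 * (ε * τ * (s ^ 2 * s)) ≤ τ * s ^ 4 * (κ / 4) := by
        have : 8 * ε ≤ κ * s := hε2.trans (by gcongr)
        have h6 : 0 ≤ τ * s ^ 3 := by positivity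
        nlinarith
      have e6 : τ * s ^ 4 * (3 / 2 * ε) ≤ τ * s ^ 4 * (κ / 4) := by
        gcongr; linarith
      have e7 : 0 < τ * s ^ 4 * κ := by positivity
      have e8 : κ * (s ^ 2) ^ 2 * τ = τ * s ^ 4 * κ := by ring
      linarith
  have hL : ∀ t, t2 ≤ t → HasDerivAt (fun t => - (√(f t))⁻¹ - ε / 2 * Real.log (1 + t))
      (- (-(g t / (2 * √(f t))) / (√(f t)) ^ 2) - ε / 2 * (1 / (1 + t))) t := fun t ht =>
    ((hsq t ht).inv (hs0pos.trans_le (hs t ht)).ne').neg.sub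
      ((((hasDerivAt_id t).const_add 1).log (by simp only [id]; linarith)).const_mul (ε / 2))
  have hmono := ode_mono (a := t2) (fun t ht => (hL t ht).continuousAt.continuousWithinAt)
    (fun t ht => hL t ht.le) (fun t ht => by
      have hb := hbar t ht.le
      have hft := hfpos t ht.le
      have hspos : 0 < √(f t) := hs0pos.trans_le (hs t ht.le)
      set s := √(f t) with hsd
      have hss : f t = s ^ 2 := (Real.sq_sqrt hft.le).symm
      have : ε / 2 * (1 / (1 + t)) ≤ (g t / (2 * s)) / s ^ 2 := by
        rw [le_div_iff₀ (by positivity), le_div_iff₀ (by positivity)]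
        rw [hss] at hb
        calc _ = ε * (1 + t)⁻¹ * (s ^ 2 * s) := by field_simp
          _ ≤ g t := hb
      rw [neg_div, neg_neg]; linarith)
  have htend : Filter.Tendsto (fun t : ℝ => ε / 2 * Real.log (1 + t)) Filter.atTop Filter.atTop :=
    (Real.tendsto_log_atTop.comp (Filter.tendsto_atTop_add_const_left _ 1 Filter.tendsto_id)).const_mul_atTop
      (by positivity)
  obtain ⟨t, htt, ht⟩ := ((htend.eventually_gt_atTop
    ((√(f t2))⁻¹ + ε / 2 * Real.log (1 + t2))).and (Filter.eventually_ge_atTop t2)).exists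
  have h1 := hmono (mem_Ici.2 le_rfl) ht ht
  simp only at h1
  have h2 : 0 < (√(f t))⁻¹ := inv_pos.2 (hs0pos.trans_le (hs t ht))
  linarith

lemma fderiv_bdd {E F : Type*} [NormedAddCommGroup E] [NormedSpace ℝ E] [NormedAddCommGroup F]
    [NormedSpace ℝ F] {f : E → F} {S K U : Set E} (hf : ContDiffOn ℝ 1 f S) (hK : IsCompact K)
    (hKS : K ⊆ S) (hU : IsOpen U) (hUS : U ⊆ S) :
    ∃ C : ℝ, 0 ≤ C ∧ ∀ q ∈ K ∩ U, ‖fderiv ℝ f q‖ ≤ C := by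
  refine hK.induction_on (p := fun s => ∃ C : ℝ, 0 ≤ C ∧ ∀ q ∈ s ∩ U, ‖fderiv ℝ f q‖ ≤ C)
    ⟨0, le_rfl, by simp⟩ ?_ ?_ ?_
  · rintro s t hst ⟨C, hC, h⟩
    exact ⟨C, hC, fun q hq => h q ⟨hst hq.1, hq.2⟩⟩
  · rintro s t ⟨C, hC, h⟩ ⟨D, hD, h'⟩
    refine ⟨max C D, le_max_of_le_left hC, ?_⟩
    rintro q ⟨hq | hq, hqU⟩
    · exact (h q ⟨hq, hqU⟩).trans (le_max_left _ _)
    · exact (h' q ⟨hq, hqU⟩).trans (le_max_right _ _)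
  · intro x hx
    have h1 := hf x (hKS hx)
    have h1' : ContDiffWithinAt ℝ (0 + 1) f S x := by simpa using h1
    obtain ⟨u, hu, -, f', hf', hc⟩ := (contDiffWithinAt_succ_iff_hasFDerivWithinAt (by simp)).1 h1'
    rw [insert_eq_of_mem (hKS hx)] at hu
    have hcc : ContinuousWithinAt f' u x := hc.continuousWithinAt
    have hb : ∀ᶠ q in 𝓝[u] x, ‖f' q‖ < ‖f' x‖ + 1 :=
      hcc.norm.eventually_lt_const (by linarith)
    have hb2 : ∀ᶠ q in 𝓝[S] x, ‖f' q‖ < ‖f' x‖ + 1 := by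
      have := Filter.Eventually.filter_mono (nhdsWithin_le_of_mem hu) hb
      exact this
    have hall : {q | ‖f' q‖ < ‖f' x‖ + 1} ∩ u ∈ 𝓝[S] x := Filter.inter_mem hb2 hu
    obtain ⟨O, hO, hxO, hOS⟩ := mem_nhdsWithin.1 hall
    refine ⟨O ∩ S, mem_nhdsWithin_of_mem_nhds (hO.mem_nhds hxO) |> fun h =>
      Filter.inter_mem h (Filter.mem_of_superset self_mem_nhdsWithin hKS), ‖f' x‖ + 1,
      by positivity, ?_⟩
    rintro q ⟨⟨hqO, hqS⟩, hqU⟩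
    have hq := hOS ⟨hqO, hqS⟩
    have hun : u ∈ 𝓝 q := Filter.mem_of_superset ((hO.inter hU).mem_nhds ⟨hqO, hqU⟩)
      (fun r hr => (hOS ⟨hr.1, hUS hr.2⟩).2)
    rw [((hf' q hq.2).hasFDerivAt hun).fderiv]
    exact hq.1.le

/-- truncation with derivative vanishing near zero -/
def chi (n : ℕ) (s : ℝ) : ℝ := min 1 (max 0 (n * |s| - 1))

def eta (n : ℕ) (s : ℝ) : ℝ := ∫ x in (0 : ℝ)..s, chi n x

lemma chi_cont (n : ℕ) : Continuous (chi n) := by unfold chi; fun_prop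

lemma chi_nonneg (n : ℕ) (s : ℝ) : 0 ≤ chi n s := by unfold chi; positivity

lemma chi_le (n : ℕ) (s : ℝ) : chi n s ≤ 1 := min_le_left _ _

lemma eta_deriv (n : ℕ) (s : ℝ) : HasDerivAt (eta n) (chi n s) s :=
  intervalIntegral.integral_hasDerivAt_right ((chi_cont n).intervalIntegrable _ _)
    ((chi_cont n).stronglyMeasurableAtFilter _ _) (chi_cont n).continuousAt

lemma chi_zero {n : ℕ} {s : ℝ} (h : n * |s| ≤ 1) : chi n s = 0 := by
  unfold chi
  rw [max_eq_left (by linarith)]; simp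

lemma eta_zero {n : ℕ} {s : ℝ} (h : n * |s| ≤ 1) : eta n s = 0 := by
  unfold eta
  rw [intervalIntegral.integral_congr (g := fun _ => 0)]
  · simp
  · intro x hx
    apply chi_zero
    refine le_trans ?_ h
    have := abs_sub_left_of_mem_uIcc hx
    exact mul_le_mul_of_nonneg_left (by simpa using this) (Nat.cast_nonneg n)

lemma chi_tendsto {s : ℝ} (h : s ≠ 0) :
    Filter.Tendsto (fun n => chi n s) Filter.atTop (𝓝 1) := by
  apply tendsto_const_nhds.congr'
  have hs : 0 < |s| := abs_pos.2 h
  filter_upwards [Filter.eventually_ge_atTop ⌈2 / |s|⌉₊] with n hn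
  have h1 : 2 / |s| ≤ n := Nat.ceil_le.1 hn
  rw [div_le_iff₀ hs] at h1
  unfold chi
  rw [min_eq_left]
  exact le_max_of_le_right (by linarith)

lemma level_set_deriv {E : Type*} [NormedAddCommGroup E] [NormedSpace ℝ E] [FiniteDimensional ℝ E]
    [MeasurableSpace E] [BorelSpace E] (μ : Measure E) [μ.IsAddHaarMeasure] {g : E → ℝ} {Z : Set E}
    (hZ : MeasurableSet Z) (h0 : ∀ x ∈ Z, g x = 0) (hd : ∀ x ∈ Z, DifferentiableAt ℝ g x) (e : E) :
    ∀ᵐ x ∂μ.restrict Z, fderiv ℝ g x e = 0 := by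
  rcases eq_or_ne e 0 with rfl | he
  · simp
  have h1 : ApproximatesLinearOn (fun x => g x • e) (0 : E →L[ℝ] E) Z 0 := by
    intro x hx y hy
    simp [h0 x hx, h0 y hy]
  have h2 := h1.norm_fderiv_sub_le μ hZ (fun x => (fderiv ℝ g x).smulRight e)
    (fun x hx => ((hd x hx).hasFDerivAt.smul_const e).hasFDerivWithinAt)
  filter_upwards [h2] with x hx
  have h3 : fderiv ℝ g x = 0 ∨ e = 0 := by simpa using hx
  simp [h3.resolve_right he]

lemma int_div_zero {E : Type*} [NormedAddCommGroup E] [NormedSpace ℝ E] [FiniteDimensional ℝ E]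
    [MeasurableSpace E] [BorelSpace E] (μ : Measure E) [μ.IsAddHaarMeasure] {Ω : Set E}
    (hΩ : IsOpen Ω) (hb : Bornology.IsBounded Ω) {g : E → ℝ} (hc : ContinuousOn g (closure Ω))
    (hfr : ∀ x ∈ frontier Ω, g x = 0) (hd : ∀ x ∈ Ω, DifferentiableAt ℝ g x) {C : ℝ}
    (hC : ∀ x ∈ Ω, ‖fderiv ℝ g x‖ ≤ C) (e : E) : ∫ x in Ω, fderiv ℝ g x e ∂μ = 0 := by
  classical
  have hfin : μ Ω < ⊤ := hb.measure_lt_top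
  have hΩm := hΩ.measurableSet
  -- derivative of truncations
  set G : ℕ → E → ℝ := fun n => Ω.indicator (fun x => eta n (g x)) with hG
  have hGd : ∀ n x, HasFDerivAt (G n)
      (Ω.indicator (fun x => chi n (g x) • fderiv ℝ g x) x) x := by
    intro n x
    by_cases hx : x ∈ Ω
    · rw [indicator_of_mem hx]
      have := (eta_deriv n (g x)).comp_hasFDerivAt x (hd x hx).hasFDerivAt
      refine this.congr_of_eventuallyEq ?_
      filter_upwards [hΩ.mem_nhds hx] with y hy
      simp [hG, hy]
    · rw [indicator_of_notMem hx]
      refine (hasFDerivAt_const (0 : ℝ) x).congr_of_eventuallyEq ?_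
      by_cases hxc : x ∈ closure Ω
      · have hx0 : g x = 0 := hfr x (by rw [hΩ.frontier_eq]; exact ⟨hxc, hx⟩)
        have h1 : ∀ᶠ y in 𝓝[closure Ω] x, n * |g y| < 1 := by
          have : ContinuousWithinAt (fun y => n * |g y|) (closure Ω) x :=
            continuousWithinAt_const.mul (hc x hxc).abs
          exact this.eventually_lt_const (by simp [hx0])
        rw [eventually_nhdsWithin_iff] at h1
        filter_upwards [h1] with y hy
        by_cases hyΩ : y ∈ Ω
        · simp only [hG, indicator_of_mem hyΩ]
          exact eta_zero (hy (subset_closure hyΩ)).le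
        · simp [hG, hyΩ]
      · filter_upwards [isClosed_closure.isOpen_compl.mem_nhds hxc] with y hy
        have : y ∉ Ω := fun h => hy (subset_closure h)
        simp [hG, this]
  have hGf : ∀ n x, fderiv ℝ (G n) x e = Ω.indicator (fun x => chi n (g x) * fderiv ℝ g x e) x := by
    intro n x
    rw [(hGd n x).fderiv]
    by_cases hx : x ∈ Ω <;> simp [hx]
  have hmeas : Measurable (fun x => fderiv ℝ g x e) := measurable_fderiv_apply_const ℝ g e
  have hgm : AEStronglyMeasurable g (μ.restrict Ω) :=
    (hc.mono subset_closure).aestronglyMeasurable hΩm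
  have hbd : ∀ x ∈ Ω, |fderiv ℝ g x e| ≤ C * ‖e‖ := fun x hx => by
    have h1 := (fderiv ℝ g x).le_opNorm e
    rw [Real.norm_eq_abs] at h1
    exact h1.trans (by gcongr; exact hC x hx)
  have hchim : ∀ n, AEStronglyMeasurable (fun x => chi n (g x) * fderiv ℝ g x e) (μ.restrict Ω) :=
    fun n => ((chi_cont n).comp_aestronglyMeasurable hgm).mul hmeas.aestronglyMeasurable
  have hbd2 : ∀ n, ∀ x ∈ Ω, ‖chi n (g x) * fderiv ℝ g x e‖ ≤ C * ‖e‖ := fun n x hx => by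
    rw [norm_mul, Real.norm_eq_abs, Real.norm_eq_abs, abs_of_nonneg (chi_nonneg _ _)]
    have := hbd x hx
    have h2 := chi_le n (g x)
    have h3 := abs_nonneg (fderiv ℝ g x e)
    nlinarith [chi_nonneg n (g x)]
  have hIntg : ∀ n, IntegrableOn (fun x => chi n (g x) * fderiv ℝ g x e) Ω μ := fun n =>
    Integrable.mono' (integrableOn_const (C := C * ‖e‖) hfin.ne) (hchim n)
      ((ae_restrict_iff' hΩm).2 (Filter.Eventually.of_forall (hbd2 n)))
  have hGcont : ∀ n, Continuous (G n) := fun n =>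
    continuous_iff_continuousAt.2 fun x => (hGd n x).continuousAt
  have hGint : ∀ n, Integrable (G n) μ := fun n => by
    refine (hGcont n).integrable_of_hasCompactSupport ?_
    refine HasCompactSupport.of_support_subset_isCompact hb.isCompact_closure ?_
    exact (support_indicator_subset).trans subset_closure
  have hz : ∀ n, ∫ x in Ω, chi n (g x) * fderiv ℝ g x e ∂μ = 0 := by
    intro n
    have h1 := integral_mul_fderiv_eq_neg_fderiv_mul_of_integrable (μ := μ) (f := fun _ : E => (1 : ℝ))
      (g := G n) (v := e) (by simp) ?_ (by simpa using hGint n) (fun x _ => by fun_prop)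
      (fun x _ => (hGd n x).differentiableAt)
    · simp only [one_mul] at h1
      simp only [hGf] at h1
      rw [integral_indicator hΩm] at h1
      simpa using h1
    · simp only [one_mul, hGf]
      exact (integrable_indicator_iff hΩm).2 (hIntg n)
  have hlim : Filter.Tendsto (fun n => ∫ x in Ω, chi n (g x) * fderiv ℝ g x e ∂μ) Filter.atTop
      (𝓝 (∫ x in Ω, fderiv ℝ g x e ∂μ)) := by
    refine tendsto_integral_of_dominated_convergence (fun _ => C * ‖e‖) hchim
      (integrableOn_const hfin.ne) (fun n => (ae_restrict_iff' hΩm).2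
      (Filter.Eventually.of_forall (hbd2 n))) ?_
    have hg0 : MeasurableSet (Ω ∩ g ⁻¹' {0}) := by
      obtain ⟨V, hV, hVe⟩ := continuousOn_iff'.1 (hc.mono subset_closure) {0}ᶜ
        isOpen_compl_singleton
      have : Ω ∩ g ⁻¹' {0} = Ω \ (V ∩ Ω) := by
        rw [← hVe]; ext x; simp +contextual
      rw [this]
      exact hΩm.diff (hV.measurableSet.inter hΩm)
    have hl := level_set_deriv μ hg0 (fun x hx => hx.2) (fun x hx => hd x hx.1) e
    rw [ae_restrict_iff' hg0] at hl
    rw [ae_restrict_iff' hΩm]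
    filter_upwards [hl] with x hx hxΩ
    by_cases h0 : g x = 0
    · rw [hx ⟨hxΩ, h0⟩]; simp
    · simpa using (chi_tendsto h0).mul_const (fderiv ℝ g x e)
  simp only [hz] at hlim
  exact (tendsto_nhds_unique hlim tendsto_const_nhds)

/-- one dimensional factors of the dominating function -/
def fac (R : ℝ) : ℕ → ℝ → ℝ
  | 0 => (Iic R).indicator (fun s => exp (s / 2 - R / 2))
  | _ + 1 => fun s => exp (-(1 / (4 * R)) * s ^ 2)

lemma fac_nonneg (R : ℝ) (i : ℕ) (s : ℝ) : 0 ≤ fac R i s := by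
  cases i with
  | zero => exact indicator_nonneg (fun _ _ => (exp_pos _).le) _
  | succ i => exact (exp_pos _).le

lemma fac_zero_int (R : ℝ) : Integrable (fac R 0) ∧ ∫ s, fac R 0 s = 2 := by
  have h1 : IntegrableOn (fun s : ℝ => exp ((1/2) * s)) (Iic R) := integrableOn_exp_mul_Iic (by norm_num) R
  have h2 : ∫ s in Iic R, exp ((1/2 : ℝ) * s) = exp ((1/2) * R) / (1/2) := integral_exp_mul_Iic (by norm_num) R
  have e : ∀ s : ℝ, exp (s / 2 - R / 2) = exp ((1/2) * s) * exp (-((1/2) * R)) := fun s => by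
    rw [← exp_add]; congr 1; ring
  constructor
  · unfold fac
    rw [integrable_indicator_iff measurableSet_Iic]
    simp only [e]
    exact h1.mul_const _
  · unfold fac
    rw [integral_indicator measurableSet_Iic]
    simp only [e]
    rw [integral_mul_const, h2, div_mul_eq_mul_div, ← exp_add]
    norm_num

lemma fac_succ_int {R : ℝ} (hR : 0 < R) (i : ℕ) :
    Integrable (fac R (i + 1)) ∧ ∫ s, fac R (i + 1) s = √(π / (1 / (4 * R))) := by
  constructor
  · exact integrable_exp_neg_mul_sq (by positivity)
  · exact integral_gaussian _

lemma vol_e0 {d : ℕ} [NeZero d] (hd3 : d ≤ 3) {R : ℝ} (hR : 1 ≤ R) :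
    ∫ y in closedBall (0 : Euc d) R, exp (y 0) ≤ 100 * R * exp R := by
  have hR0 : 0 < R := by linarith
  have hI : ∀ i, Integrable (fac R i) := fun i => by
    cases i with
    | zero => exact (fac_zero_int R).1
    | succ i => exact (fac_succ_int hR0 i).1
  have hprod : Integrable (fun x : Fin d → ℝ => ∏ i, fac R i.1 (x i)) :=
    Integrable.fintype_prod (f := fun (i : Fin d) => fac R i.1) (fun i => hI i)
  have hmp := EuclideanSpace.volume_preserving_symm_measurableEquiv_toLp (Fin d)
  have hprodE : Integrable (fun y : Euc d => ∏ i, fac R i.1 (y i)) := by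
    exact hmp.integrable_comp_of_integrable hprod
  have hval : ∫ y : Euc d, ∏ i, fac R i.1 (y i) ≤ 100 * R := by
    have h1 : ∫ y : Euc d, ∏ i, fac R i.1 (y i) = ∫ x : Fin d → ℝ, ∏ i, fac R i.1 (x i) :=
      hmp.integral_comp (MeasurableEquiv.measurableEmbedding _) (fun x : Fin d → ℝ => ∏ i, fac R i.1 (x i))
    rw [h1, integral_fintype_prod_volume_eq_prod (fun i : Fin d => fac R i.1)]
    obtain ⟨k, rfl⟩ : ∃ k, d = k + 1 := Nat.exists_eq_succ_of_ne_zero (NeZero.ne d)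
    rw [Fin.prod_univ_succ]
    simp only [Fin.val_zero, Fin.val_succ, (fac_zero_int R).2, (fac_succ_int hR0 _).2,
      Finset.prod_const, Finset.card_univ, Fintype.card_fin]
    have hs : π / (1 / (4 * R)) = 4 * π * R := by field_simp
    rw [hs]
    have hpi := pi_gt_three
    have hpi4 := pi_le_four
    have h16 : √(4 * π * R) ^ 2 = 4 * π * R := Real.sq_sqrt (by positivity)
    have h1' : 1 ≤ √(4 * π * R) := by
      rw [Real.one_le_sqrt]; nlinarith
    have : √(4 * π * R) ^ k ≤ √(4 * π * R) ^ 2 := pow_le_pow_right₀ h1' (by omega)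
    nlinarith
  have hpt : ∀ y ∈ closedBall (0 : Euc d) R, exp (y 0) ≤ exp R * ∏ i, fac R i.1 (y i) := by
    intro y hy
    rw [mem_closedBall_zero_iff, EuclideanSpace.norm_eq, Real.sqrt_le_left (by linarith)] at hy
    obtain ⟨k, rfl⟩ : ∃ k, d = k + 1 := Nat.exists_eq_succ_of_ne_zero (NeZero.ne d)
    simp only [Real.norm_eq_abs, sq_abs] at hy
    rw [Fin.sum_univ_succ] at hy
    rw [Fin.prod_univ_succ]
    set q := ∑ i : Fin k, y i.succ ^ 2 with hq
    have hq0 : 0 ≤ q := Finset.sum_nonneg fun i _ => sq_nonneg _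
    have hyR : y 0 ≤ R := by nlinarith
    simp only [Fin.val_zero, Fin.val_succ, fac, indicator_of_mem (show y 0 ∈ Iic R from hyR)]
    rw [← Real.exp_sum, ← exp_add, ← exp_add, exp_le_exp, ← Finset.mul_sum, ← hq]
    have : 1 / (4 * R) * q ≤ (R - y 0) / 2 := by
      rw [div_mul_eq_mul_div, div_le_iff₀ (by positivity)]
      nlinarith
    linarith
  calc ∫ y in closedBall (0 : Euc d) R, exp (y 0)
      ≤ ∫ y in closedBall (0 : Euc d) R, exp R * ∏ i, fac R i.1 (y i) := by
        refine setIntegral_mono_on ?_ (hprodE.const_mul _).integrableOn measurableSet_closedBall hpt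
        exact ContinuousOn.integrableOn_compact (isCompact_closedBall _ _) (by fun_prop)
    _ ≤ ∫ y : Euc d, exp R * ∏ i, fac R i.1 (y i) :=
        setIntegral_le_integral (hprodE.const_mul _) (Filter.Eventually.of_forall fun y =>
          mul_nonneg (exp_pos _).le (Finset.prod_nonneg fun i _ => fac_nonneg _ _ _))
    _ ≤ 100 * R * exp R := by
        rw [integral_const_mul]; nlinarith [exp_pos R]

lemma vol_bound {d : ℕ} (hd1 : 1 ≤ d) (hd3 : d ≤ 3) {R : ℝ} (hR : 1 ≤ R) {ω : Euc d}
    (hω : ‖ω‖ = 1) : ∫ y in closedBall (0 : Euc d) R, exp ⟪ω, y⟫ ≤ 100 * R * exp R := by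
  have : NeZero d := ⟨by omega⟩
  set e : Euc d := EuclideanSpace.single 0 1 with he
  have hn : ‖e‖ = ‖ω‖ := by rw [hω]; simp [he]
  set φ := (ℝ ∙ (e - ω))ᗮ.reflection with hφ
  have hφe : φ e = ω := Submodule.reflection_sub hn
  have hmp : MeasurePreserving φ := φ.measurePreserving
  have h1 := hmp.setIntegral_preimage_emb φ.toHomeomorph.measurableEmbedding
    (fun y => exp ⟪ω, y⟫) (closedBall 0 R)
  rw [← h1]
  have h2 : φ ⁻¹' closedBall 0 R = closedBall 0 R := by
    ext y; simp
  rw [h2]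
  refine le_trans (le_of_eq ?_) (vol_e0 hd3 hR)
  congr 1; ext y
  rw [← hφe, LinearIsometryEquiv.inner_map_map, he, EuclideanSpace.inner_single_left]
  simp

/-- space-time -/
abbrev XX (d m : ℕ) : Type := ℝ × Euc d × Euc m

/-- closed space-time domain -/
def SS (d : ℕ) {m : ℕ} (Ω : Set (Euc m)) : Set (XX d m) := Ici 0 ×ˢ univ ×ˢ closure Ω

/-- open space-time domain -/
def UU (d : ℕ) {m : ℕ} (Ω : Set (Euc m)) : Set (XX d m) := Ioi 0 ×ˢ univ ×ˢ Ω

/-- space measure -/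
def nuu (d : ℕ) {m : ℕ} (Ω : Set (Euc m)) : Measure (Euc d × Euc m) :=
  (volume : Measure (Euc d)).prod (volume.restrict Ω)

/-- support condition -/
def Supp {d m : ℕ} (Ω : Set (Euc m)) (f : XX d m → ℝ) : Prop :=
  ∀ q ∈ SS d Ω, 1 + q.1 < ‖q.2.1‖ → f q = 0

section cons
variable {d m : ℕ} {Ω : Set (Euc m)}

lemma UU_sub : UU d Ω ⊆ SS d Ω :=
  prod_mono Ioi_subset_Ici_self (prod_mono le_rfl subset_closure)

lemma UU_open (hΩ : IsOpen Ω) : IsOpen (UU d Ω) := isOpen_Ioi.prod (isOpen_univ.prod hΩ)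

lemma nuu_eq : nuu d Ω = (volume : Measure (Euc d × Euc m)).restrict (univ ×ˢ Ω) := by
  unfold nuu
  rw [Measure.volume_eq_prod, ← Measure.prod_restrict, Measure.restrict_univ]

lemma nuu_ae (hΩ : IsOpen Ω) {P : Euc d × Euc m → Prop} (h : ∀ p, p.2 ∈ Ω → P p) :
    ∀ᵐ p ∂nuu d Ω, P p := by
  rw [nuu_eq, ae_restrict_iff' (MeasurableSet.univ.prod hΩ.measurableSet)]
  exact Filter.Eventually.of_forall fun p hp => h p hp.2

/-- dominating function -/
def bdd (d m : ℕ) (M R : ℝ) : Euc d × Euc m → ℝ :=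
  (closedBall (0 : Euc d) R ×ˢ univ).indicator (fun _ => M)

lemma bdd_int (hb : Bornology.IsBounded Ω) (M R : ℝ) : Integrable (bdd d m M R) (nuu d Ω) := by
  unfold bdd
  rw [integrable_indicator_iff (measurableSet_closedBall.prod MeasurableSet.univ)]
  refine integrableOn_const (ne_of_lt ?_)
  unfold nuu
  rw [Measure.prod_prod]
  refine ENNReal.mul_lt_top measure_closedBall_lt_top ?_
  simpa using hb.measure_lt_top

lemma le_bdd {M R : ℝ} {k : ℝ} {p : Euc d × Euc m} (h1 : ‖p.1‖ ≤ R → |k| ≤ M)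
    (h2 : R < ‖p.1‖ → k = 0) : ‖k‖ ≤ bdd d m M R p := by
  unfold bdd
  rcases le_or_gt ‖p.1‖ R with h | h
  · rw [indicator_of_mem (by simpa using h)]; exact h1 h
  · rw [indicator_of_notMem (by simpa using h), h2 h]; simp

lemma slice_meas (hΩ : IsOpen Ω) {f : XX d m → ℝ} {t : ℝ}
    (h : ContinuousOn (fun p => f (t, p)) (univ ×ˢ Ω)) :
    AEStronglyMeasurable (fun p => f (t, p)) (nuu d Ω) := by
  rw [nuu_eq]
  exact h.aestronglyMeasurable (MeasurableSet.univ.prod hΩ.measurableSet)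

lemma val_bdd (hb : Bornology.IsBounded Ω) {f : XX d m → ℝ} (hf : ContinuousOn f (SS d Ω)) (t1 : ℝ) :
    ∃ M, ∀ t y z, 0 ≤ t → t ≤ t1 → ‖y‖ ≤ 1 + t1 → z ∈ closure Ω → |f (t, y, z)| ≤ M := by
  have hK : IsCompact (Icc 0 t1 ×ˢ closedBall (0 : Euc d) (1 + t1) ×ˢ closure Ω) :=
    isCompact_Icc.prod ((isCompact_closedBall _ _).prod hb.isCompact_closure)
  obtain ⟨M, hM⟩ := hK.exists_bound_of_continuousOn (f := f)
    (hf.mono (prod_mono Icc_subset_Ici_self (prod_mono (subset_univ _) le_rfl)))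
  exact ⟨M, fun t y z h0 h1 hy hz => hM (t, y, z) ⟨⟨h0, h1⟩, by simpa using hy, hz⟩⟩

lemma der_bdd (hΩ : IsOpen Ω) (hb : Bornology.IsBounded Ω) {f : XX d m → ℝ}
    (hf : ContDiffOn ℝ 1 f (SS d Ω)) (t1 : ℝ) (v : XX d m) :
    ∃ M, ∀ t y z, 0 < t → t ≤ t1 → ‖y‖ ≤ 1 + t1 → z ∈ Ω → |fderiv ℝ f (t, y, z) v| ≤ M := by
  have hK : IsCompact (Icc 0 t1 ×ˢ closedBall (0 : Euc d) (1 + t1) ×ˢ closure Ω) :=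
    isCompact_Icc.prod ((isCompact_closedBall _ _).prod hb.isCompact_closure)
  obtain ⟨M, hM0, hM⟩ := fderiv_bdd hf hK
    (prod_mono Icc_subset_Ici_self (prod_mono (subset_univ _) le_rfl)) (UU_open hΩ) UU_sub
  refine ⟨M * ‖v‖, fun t y z h0 h1 hy hz => ?_⟩
  have := hM (t, y, z) ⟨⟨⟨h0.le, h1⟩, by simpa using hy, subset_closure hz⟩, h0, mem_univ _, hz⟩
  exact ((fderiv ℝ f (t, y, z)).le_opNorm v).trans (by gcongr)

lemma der_supp (hΩ : IsOpen Ω) {f : XX d m → ℝ} (hs : Supp Ω f) {q : XX d m} (hq : q ∈ UU d Ω)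
    (h : 1 + q.1 < ‖q.2.1‖) : fderiv ℝ f q = 0 := by
  have hO : IsOpen (UU d Ω ∩ {q | 1 + q.1 < ‖q.2.1‖}) :=
    (UU_open hΩ).inter (isOpen_lt (by fun_prop) (by fun_prop))
  have : f =ᶠ[𝓝 q] fun _ => 0 := by
    filter_upwards [hO.mem_nhds ⟨hq, h⟩] with r hr
    exact hs r (UU_sub hr.1) hr.2
  rw [this.fderiv_eq]; simp

lemma diffAt (hΩ : IsOpen Ω) {f : XX d m → ℝ} (hf : ContDiffOn ℝ 1 f (SS d Ω)) {q : XX d m}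
    (hq : q ∈ UU d Ω) : DifferentiableAt ℝ f q :=
  ((hf.mono UU_sub).differentiableOn (by simp)).differentiableAt ((UU_open hΩ).mem_nhds hq)

lemma der_cont (hΩ : IsOpen Ω) {f : XX d m → ℝ} (hf : ContDiffOn ℝ 1 f (SS d Ω)) (v : XX d m) :
    ContinuousOn (fun q => fderiv ℝ f q v) (UU d Ω) :=
  ((hf.mono UU_sub).continuousOn_fderiv_of_isOpen (UU_open hΩ) le_rfl).clm_apply continuousOn_const

lemma slice_val_cont {f : XX d m → ℝ} (hf : ContinuousOn f (SS d Ω)) {t : ℝ} (ht : 0 ≤ t) :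
    ContinuousOn (fun p => f (t, p)) (univ ×ˢ Ω) :=
  hf.comp (by fun_prop) (fun p hp => ⟨ht, mem_univ _, subset_closure hp.2⟩)

lemma int_val (hΩ : IsOpen Ω) (hb : Bornology.IsBounded Ω) {f : XX d m → ℝ}
    (hf : ContinuousOn f (SS d Ω)) (hs : Supp Ω f) {t : ℝ} (ht : 0 ≤ t) :
    Integrable (fun p => f (t, p)) (nuu d Ω) := by
  obtain ⟨M, hM⟩ := val_bdd hb hf t
  refine Integrable.mono' (bdd_int hb M (1 + t)) (slice_meas hΩ (slice_val_cont hf ht)) ?_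
  exact nuu_ae hΩ fun p hp => le_bdd (fun h => hM t p.1 p.2 ht le_rfl h (subset_closure hp))
    (fun h => hs (t, p) ⟨ht, mem_univ _, subset_closure hp⟩ h)

lemma slice_der_meas (hΩ : IsOpen Ω) {f : XX d m → ℝ} (hf : ContDiffOn ℝ 1 f (SS d Ω)) {t : ℝ}
    (ht : 0 < t) (v : XX d m) :
    AEStronglyMeasurable (fun p => fderiv ℝ f (t, p) v) (nuu d Ω) :=
  slice_meas (f := fun q => fderiv ℝ f q v) hΩ
    ((der_cont hΩ hf v).comp (by fun_prop) (fun p hp => ⟨ht, mem_univ _, hp.2⟩))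

lemma int_der (hΩ : IsOpen Ω) (hb : Bornology.IsBounded Ω) {f : XX d m → ℝ}
    (hf : ContDiffOn ℝ 1 f (SS d Ω)) (hs : Supp Ω f) {t : ℝ} (ht : 0 < t) (v : XX d m) :
    Integrable (fun p => fderiv ℝ f (t, p) v) (nuu d Ω) := by
  obtain ⟨M, hM⟩ := der_bdd hΩ hb hf t v
  refine Integrable.mono' (bdd_int hb M (1 + t)) (slice_der_meas hΩ hf ht v) ?_
  exact nuu_ae hΩ fun p hp => le_bdd (fun h => hM t p.1 p.2 ht le_rfl h hp)
    (fun h => by rw [der_supp hΩ hs (q := (t, p)) ⟨ht, mem_univ _, hp⟩ h]; simp)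

lemma cont_int (hΩ : IsOpen Ω) (hb : Bornology.IsBounded Ω) {f : XX d m → ℝ}
    (hf : ContinuousOn f (SS d Ω)) (hs : Supp Ω f) :
    ContinuousOn (fun t => ∫ p, f (t, p) ∂nuu d Ω) (Ici 0) := by
  intro t ht
  obtain ⟨M, hM⟩ := val_bdd hb hf (t + 1)
  have hev : ∀ᶠ s in 𝓝[Ici 0] t, 0 ≤ s ∧ s ≤ t + 1 :=
    (eventually_mem_nhdsWithin).and (mem_nhdsWithin_of_mem_nhds (Iic_mem_nhds (by linarith)))
  refine continuousWithinAt_of_dominated (bound := bdd d m M (1 + (t + 1))) ?_ ?_ (bdd_int hb _ _) ?_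
  · filter_upwards [hev] with s hs'
    exact slice_meas hΩ (slice_val_cont hf hs'.1)
  · filter_upwards [hev] with s hs'
    exact nuu_ae hΩ fun p hp => le_bdd (fun h => hM s p.1 p.2 hs'.1 hs'.2 h (subset_closure hp))
      (fun h => hs (s, p) ⟨hs'.1, mem_univ _, subset_closure hp⟩ (by simp only; linarith [hs'.2]))
  · refine nuu_ae hΩ fun p hp => ?_
    exact ContinuousWithinAt.comp (f := fun s : ℝ => (s, p)) (t := SS d Ω)
      (hf (t, p) ⟨ht, mem_univ _, subset_closure hp⟩) (by fun_prop)
      (fun s hs => ⟨hs, mem_univ _, subset_closure hp⟩)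

lemma deriv_int (hΩ : IsOpen Ω) (hb : Bornology.IsBounded Ω) {f : XX d m → ℝ}
    (hf : ContDiffOn ℝ 1 f (SS d Ω)) (hs : Supp Ω f) {t : ℝ} (ht : 0 < t) :
    HasDerivAt (fun t => ∫ p, f (t, p) ∂nuu d Ω)
      (∫ p, fderiv ℝ f (t, p) (1, 0, 0) ∂nuu d Ω) t := by
  obtain ⟨M, hM⟩ := der_bdd hΩ hb hf (t + 1) (1, 0, 0)
  refine (hasDerivAt_integral_of_dominated_loc_of_deriv_le (s := Ioo 0 (t + 1))
    (bound := bdd d m M (1 + (t + 1)))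
    (F' := fun t p => fderiv ℝ f (t, p) (1, 0, 0))
    (Ioo_mem_nhds ht (by linarith)) ?_ (int_val hΩ hb hf.continuousOn hs ht.le)
    (slice_der_meas hΩ hf ht _) ?_ (bdd_int hb _ _) ?_).2
  · filter_upwards [Ioi_mem_nhds ht] with s hs'
    exact slice_meas hΩ (slice_val_cont hf.continuousOn (le_of_lt hs'))
  · refine nuu_ae hΩ fun p hp s hs' => le_bdd (fun h => hM s p.1 p.2 hs'.1 hs'.2.le h hp)
      (fun h => by
        rw [der_supp hΩ hs (q := (s, p)) ⟨hs'.1, mem_univ _, hp⟩ (by simp only; linarith [hs'.2])]; simp)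
  · refine nuu_ae hΩ fun p hp s hs' => ?_
    have h1 := (diffAt hΩ hf (q := (s, p)) ⟨hs'.1, mem_univ _, hp⟩).hasFDerivAt
    have h2 : HasDerivAt (fun s : ℝ => (s, p)) ((1 : ℝ), (0 : Euc d × Euc m)) s :=
      (hasDerivAt_id s).prodMk (hasDerivAt_const _ _)
    exact h1.comp_hasDerivAt s h2

lemma y_int (hΩ : IsOpen Ω) (hb : Bornology.IsBounded Ω) {f : XX d m → ℝ}
    (hf : ContDiffOn ℝ 1 f (SS d Ω)) (hs : Supp Ω f) {t : ℝ} (ht : 0 < t) (e : Euc d) :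
    ∫ p, fderiv ℝ f (t, p) (0, e, 0) ∂nuu d Ω = 0 := by
  have hI := int_der hΩ hb hf hs ht (0, e, 0)
  unfold nuu at hI ⊢
  rw [integral_prod_symm _ hI]
  refine integral_eq_zero_of_ae ?_
  rw [Filter.EventuallyEq, ae_restrict_iff' hΩ.measurableSet]
  refine Filter.Eventually.of_forall fun z hz => ?_
  simp only [Pi.zero_apply]
  have hb1 : ContDiff ℝ 1 (fun y => f (t, y, z)) := by
    rw [← contDiffOn_univ]
    exact (hf.mono UU_sub).comp (t := UU d Ω) (f := fun y : Euc d => (t, y, z)) (by fun_prop)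
      (fun y _ => ⟨ht, mem_univ _, hz⟩)
  have hder : ∀ y, fderiv ℝ f (t, y, z) (0, e, 0) = fderiv ℝ (fun y => f (t, y, z)) y e := by
    intro y
    have h1 := (diffAt hΩ hf (q := (t, y, z)) ⟨ht, mem_univ _, hz⟩).hasFDerivAt
    have h2 : HasFDerivAt (fun y : Euc d => (t, y, z))
        ((0 : Euc d →L[ℝ] ℝ).prod ((ContinuousLinearMap.id ℝ (Euc d)).prod (0 : Euc d →L[ℝ] Euc m))) y :=
      (hasFDerivAt_const t y).prodMk ((hasFDerivAt_id y).prodMk (hasFDerivAt_const z y))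
    have h3 := h1.comp y h2
    have h4 : fderiv ℝ (fun y => f (t, y, z)) y = _ := h3.fderiv
    rw [h4]; simp
  have hcs : HasCompactSupport (fun y => f (t, y, z)) := by
    refine HasCompactSupport.intro (isCompact_closedBall 0 (1 + t)) fun y hy => ?_
    exact hs (t, y, z) ⟨ht.le, mem_univ _, subset_closure hz⟩ (by simpa using hy)
  simp only [hder]
  have hcs' := hcs.fderiv_apply ℝ e
  have h1 := integral_mul_fderiv_eq_neg_fderiv_mul_of_integrable (μ := volume)
    (f := fun _ : Euc d => (1 : ℝ)) (g := fun y => f (t, y, z)) (v := e) (by simp) ?_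
    (by simpa using hb1.continuous.integrable_of_hasCompactSupport hcs) (fun x _ => by fun_prop)
    (fun x _ => (hb1.differentiable (by simp)).differentiableAt)
  · simpa using h1
  · simp only [one_mul]
    exact (hb1.continuous_fderiv_apply (by simp) |>.comp (by fun_prop :
      Continuous fun y : Euc d => (y, e))).integrable_of_hasCompactSupport hcs'

lemma z_int (hΩ : IsOpen Ω) (hb : Bornology.IsBounded Ω) {f : XX d m → ℝ}
    (hf : ContDiffOn ℝ 1 f (SS d Ω)) (hs : Supp Ω f)
    (hfr : ∀ t y z, 0 < t → z ∈ frontier Ω → f (t, y, z) = 0) {t : ℝ} (ht : 0 < t) (e : Euc m) :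
    ∫ p, fderiv ℝ f (t, p) (0, 0, e) ∂nuu d Ω = 0 := by
  have hI := int_der hΩ hb hf hs ht (0, 0, e)
  unfold nuu at hI ⊢
  rw [integral_prod _ hI]
  refine integral_eq_zero_of_ae (Filter.Eventually.of_forall fun y => ?_)
  simp only [Pi.zero_apply]
  have hb1 : ContDiffOn ℝ 1 (fun z => f (t, y, z)) (closure Ω) :=
    hf.comp (t := SS d Ω) (f := fun z : Euc m => (t, y, z)) (by fun_prop)
      (fun z hz => ⟨ht.le, mem_univ _, hz⟩)
  have hder0 : ∀ z ∈ Ω, HasFDerivAt (fun z => f (t, y, z)) ((fderiv ℝ f (t, y, z)).comp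
      ((0 : Euc m →L[ℝ] ℝ).prod ((0 : Euc m →L[ℝ] Euc d).prod (ContinuousLinearMap.id ℝ (Euc m))))) z := by
    intro z hz
    have h1 := (diffAt hΩ hf (q := (t, y, z)) ⟨ht, mem_univ _, hz⟩).hasFDerivAt
    have h2 : HasFDerivAt (fun z : Euc m => (t, y, z))
        ((0 : Euc m →L[ℝ] ℝ).prod ((0 : Euc m →L[ℝ] Euc d).prod (ContinuousLinearMap.id ℝ (Euc m)))) z :=
      (hasFDerivAt_const t z).prodMk ((hasFDerivAt_const y z).prodMk (hasFDerivAt_id z))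
    exact h1.comp z h2
  obtain ⟨C, -, hC⟩ := fderiv_bdd hb1 hb.isCompact_closure le_rfl hΩ subset_closure
  have := int_div_zero volume hΩ hb hb1.continuousOn (fun z hz => hfr t y z ht hz)
    (fun z hz => (hder0 z hz).differentiableAt) (fun z hz => hC z ⟨subset_closure hz, hz⟩) e
  refine Eq.trans ?_ this
  refine setIntegral_congr_fun hΩ.measurableSet fun z hz => ?_
  rw [(hder0 z hz).fderiv]; simp

/-- integrated conservation law with source -/
lemma conserve_core (hΩ : IsOpen Ω) (hb : Bornology.IsBounded Ω) {A Q : XX d m → ℝ}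
    {B : Fin d → XX d m → ℝ} {C : Fin m → XX d m → ℝ}
    (hA : ContDiffOn ℝ 1 A (SS d Ω)) (hB : ∀ i, ContDiffOn ℝ 1 (B i) (SS d Ω))
    (hC : ∀ k, ContDiffOn ℝ 1 (C k) (SS d Ω))
    (sA : Supp Ω A) (sB : ∀ i, Supp Ω (B i)) (sC : ∀ k, Supp Ω (C k))
    (hfr : ∀ k t y z, 0 < t → z ∈ frontier Ω → C k (t, y, z) = 0)
    (hpde : ∀ q ∈ UU d Ω, fderiv ℝ A q (1, 0, 0)
      + (∑ i, fderiv ℝ (B i) q (0, EuclideanSpace.single i 1, 0))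
      + (∑ k, fderiv ℝ (C k) q (0, 0, EuclideanSpace.single k 1)) = Q q) {t : ℝ} (ht : 0 < t) :
    HasDerivAt (fun t => ∫ p, A (t, p) ∂nuu d Ω) (∫ p, Q (t, p) ∂nuu d Ω) t := by
  have h := deriv_int hΩ hb hA sA ht
  convert h using 1
  have h1 : ∫ p, Q (t, p) ∂nuu d Ω = ∫ p, (fderiv ℝ A (t, p) (1, 0, 0)
      + (∑ i, fderiv ℝ (B i) (t, p) (0, EuclideanSpace.single i 1, 0))
      + (∑ k, fderiv ℝ (C k) (t, p) (0, 0, EuclideanSpace.single k 1))) ∂nuu d Ω :=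
    integral_congr_ae (nuu_ae hΩ fun p hp => (hpde (t, p) ⟨ht, mem_univ _, hp⟩).symm)
  have i1 := int_der hΩ hb hA sA ht (1, 0, 0)
  have i2 := fun i => int_der hΩ hb (hB i) (sB i) ht (0, EuclideanSpace.single i 1, 0)
  have i3 := fun k => int_der hΩ hb (hC k) (sC k) ht (0, 0, EuclideanSpace.single k 1)
  have i2' := integrable_finsetSum Finset.univ (fun i _ => i2 i)
  have i3' := integrable_finsetSum Finset.univ (fun i _ => i3 i)
  have i12 : Integrable (fun p => fderiv ℝ A (t, p) (1, 0, 0)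
      + (∑ i, fderiv ℝ (B i) (t, p) (0, EuclideanSpace.single i 1, 0))) (nuu d Ω) := i1.add i2'
  rw [h1, integral_add i12 i3', integral_add i1 i2',
    integral_finsetSum _ (fun i _ => i2 i), integral_finsetSum _ (fun i _ => i3 i)]
  simp only [y_int hΩ hb (hB _) (sB _) ht, z_int hΩ hb (hC _) (sC _) (hfr _) ht]
  simp

/-- integrated conservation law tested against a plane wave -/
lemma conserve (hΩ : IsOpen Ω) (hb : Bornology.IsBounded Ω) (ω : Euc d) {A : XX d m → ℝ}
    {B : Fin d → XX d m → ℝ} {C : Fin m → XX d m → ℝ}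
    (hA : ContDiffOn ℝ 1 A (SS d Ω)) (hB : ∀ i, ContDiffOn ℝ 1 (B i) (SS d Ω))
    (hC : ∀ k, ContDiffOn ℝ 1 (C k) (SS d Ω))
    (sA : Supp Ω A) (sB : ∀ i, Supp Ω (B i)) (sC : ∀ k, Supp Ω (C k))
    (hfr : ∀ k t y z, 0 < t → z ∈ frontier Ω → C k (t, y, z) = 0)
    (hpde : ∀ q ∈ UU d Ω, fderiv ℝ A q (1, 0, 0)
      + (∑ i, fderiv ℝ (B i) q (0, EuclideanSpace.single i 1, 0))
      + (∑ k, fderiv ℝ (C k) q (0, 0, EuclideanSpace.single k 1)) = 0) {t : ℝ} (ht : 0 < t) :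
    HasDerivAt (fun t => ∫ p, exp ⟪ω, p.1⟫ * A (t, p) ∂nuu d Ω)
      (∫ p, exp ⟪ω, p.1⟫ * ∑ i, ω i * B i (t, p) ∂nuu d Ω) t := by
  have hE : ContDiff ℝ 1 (fun q : XX d m => exp ⟪ω, q.2.1⟫) :=
    (contDiff_const.inner ℝ contDiff_snd.fst).exp
  have hEd : ∀ q : XX d m, ∀ s y z, fderiv ℝ (fun q : XX d m => exp ⟪ω, q.2.1⟫) q (s, y, z) =
      exp ⟪ω, q.2.1⟫ * ⟪ω, y⟫ := by
    intro q s y z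
    have h1 : HasFDerivAt (fun q : XX d m => ⟪ω, q.2.1⟫)
      ((innerSL ℝ ω).comp ((ContinuousLinearMap.fst ℝ (Euc d) (Euc m)).comp
        (ContinuousLinearMap.snd ℝ ℝ (Euc d × Euc m)))) q :=
      ((innerSL ℝ ω).comp ((ContinuousLinearMap.fst ℝ (Euc d) (Euc m)).comp
        (ContinuousLinearMap.snd ℝ ℝ (Euc d × Euc m)))).hasFDerivAt
    rw [h1.exp.fderiv]
    simp
  have hmul : ∀ (f : XX d m → ℝ), ContDiffOn ℝ 1 f (SS d Ω) → ∀ q ∈ UU d Ω, ∀ s y z,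
      fderiv ℝ (fun q => exp ⟪ω, q.2.1⟫ * f q) q (s, y, z) =
        exp ⟪ω, q.2.1⟫ * fderiv ℝ f q (s, y, z) + exp ⟪ω, q.2.1⟫ * ⟪ω, y⟫ * f q := by
    intro f hf q hq s y z
    rw [fderiv_fun_mul (hE.differentiable (by simp)).differentiableAt (diffAt hΩ hf hq)]
    simp only [add_apply, smul_apply, smul_eq_mul, hEd]
    ring
  have hsm : ∀ (f : XX d m → ℝ), Supp Ω f → Supp Ω (fun q => exp ⟪ω, q.2.1⟫ * f q) := by
    intro f hf q hq h; simp [hf q hq h]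
  refine conserve_core hΩ hb (A := fun q => exp ⟪ω, q.2.1⟫ * A q)
    (B := fun i q => exp ⟪ω, q.2.1⟫ * B i q) (C := fun k q => exp ⟪ω, q.2.1⟫ * C k q)
    (Q := fun q => exp ⟪ω, q.2.1⟫ * ∑ i, ω i * B i q)
    (hE.contDiffOn.mul hA) (fun i => hE.contDiffOn.mul (hB i)) (fun k => hE.contDiffOn.mul (hC k))
    (hsm _ sA) (fun i => hsm _ (sB i)) (fun k => hsm _ (sC k))
    (fun k t y z ht hz => by simp [hfr k t y z ht hz]) ?_ ht
  intro q hq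
  simp only [hmul A hA q hq, hmul (B _) (hB _) q hq, hmul (C _) (hC _) q hq]
  have h0 := hpde q hq
  have hin : ∀ i, ⟪ω, EuclideanSpace.single i (1 : ℝ)⟫ = ω i := fun i => by
    rw [EuclideanSpace.inner_single_right]; simp
  simp only [inner_zero_right, mul_zero, zero_mul, add_zero, Finset.sum_add_distrib, hin,
    ← Finset.mul_sum]
  have h2 : ∑ i, exp ⟪ω, q.2.1⟫ * ω i * B i q = exp ⟪ω, q.2.1⟫ * ∑ i, ω i * B i q := by
    rw [Finset.mul_sum]; exact Finset.sum_congr rfl fun i _ => by ring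
  rw [h2]
  linear_combination exp ⟪ω, q.2.1⟫ * h0

end cons

section main1
variable {d m : ℕ} {Ω : Set (Euc m)}

instance : SFinite (nuu d Ω) := by unfold nuu; infer_instance

instance : IsFiniteMeasure (sphμ d) := by unfold sphμ; infer_instance

lemma pdv_y (hΩ : IsOpen Ω) {f : XX d m → ℝ} (hf : ContDiffOn ℝ 1 f (SS d Ω)) {t : ℝ} {y : Euc d}
    {z : Euc m} (ht : 0 < t) (hz : z ∈ Ω) (i : Fin d) :
    pdv i (fun y' => f (t, y', z)) y = fderiv ℝ f (t, y, z) (0, EuclideanSpace.single i 1, 0) := by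
  have h1 := (diffAt hΩ hf (q := (t, y, z)) ⟨ht, mem_univ _, hz⟩).hasFDerivAt
  have h2 : HasFDerivAt (fun y : Euc d => (t, y, z))
      ((0 : Euc d →L[ℝ] ℝ).prod ((ContinuousLinearMap.id ℝ (Euc d)).prod (0 : Euc d →L[ℝ] Euc m))) y :=
    (hasFDerivAt_const t y).prodMk ((hasFDerivAt_id y).prodMk (hasFDerivAt_const z y))
  have h3 := h1.comp y h2
  have h4 : fderiv ℝ (fun y => f (t, y, z)) y = _ := h3.fderiv
  unfold pdv
  rw [h4]; simp

lemma pdv_z (hΩ : IsOpen Ω) {f : XX d m → ℝ} (hf : ContDiffOn ℝ 1 f (SS d Ω)) {t : ℝ} {y : Euc d}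
    {z : Euc m} (ht : 0 < t) (hz : z ∈ Ω) (k : Fin m) :
    pdv k (fun z' => f (t, y, z')) z = fderiv ℝ f (t, y, z) (0, 0, EuclideanSpace.single k 1) := by
  have h1 := (diffAt hΩ hf (q := (t, y, z)) ⟨ht, mem_univ _, hz⟩).hasFDerivAt
  have h2 : HasFDerivAt (fun z : Euc m => (t, y, z))
      ((0 : Euc m →L[ℝ] ℝ).prod ((0 : Euc m →L[ℝ] Euc d).prod (ContinuousLinearMap.id ℝ (Euc m)))) z :=
    (hasFDerivAt_const t z).prodMk ((hasFDerivAt_const y z).prodMk (hasFDerivAt_id z))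
  have h3 := h1.comp z h2
  have h4 : fderiv ℝ (fun z => f (t, y, z)) z = _ := h3.fderiv
  unfold pdv
  rw [h4]; simp

lemma pdv_t (hΩ : IsOpen Ω) {f : XX d m → ℝ} (hf : ContDiffOn ℝ 1 f (SS d Ω)) {t : ℝ} {y : Euc d}
    {z : Euc m} (ht : 0 < t) (hz : z ∈ Ω) :
    derivWithin (fun s => f (s, y, z)) (Ici 0) t = fderiv ℝ f (t, y, z) (1, 0, 0) := by
  have h1 := (diffAt hΩ hf (q := (t, y, z)) ⟨ht, mem_univ _, hz⟩).hasFDerivAt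
  have h2 : HasDerivAt (fun s : ℝ => (s, y, z)) ((1 : ℝ), (0 : Euc d), (0 : Euc m)) t :=
    (hasDerivAt_id t).prodMk (hasDerivAt_const t (y, z))
  have h3 := h1.comp_hasDerivAt t h2
  exact h3.hasDerivWithinAt.derivWithin (uniqueDiffOn_Ici 0 t ht.le)

lemma fderiv_lin (hΩ : IsOpen Ω) {ι : Type*} [Fintype ι] {f : ι → XX d m → ℝ}
    (hf : ∀ j, ContDiffOn ℝ 1 (f j) (SS d Ω)) (c : ι → ℝ) {q : XX d m} (hq : q ∈ UU d Ω)
    (x : XX d m) : fderiv ℝ (fun q => ∑ j, c j * f j q) q x = ∑ j, c j * fderiv ℝ (f j) q x := by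
  have h : HasFDerivAt (fun q => ∑ j, c j * f j q) (∑ j, c j • fderiv ℝ (f j) q) q :=
    HasFDerivAt.fun_sum fun j _ => ((diffAt hΩ (hf j) hq).hasFDerivAt.const_mul (c j))
  rw [h.fderiv]
  simp

lemma swap_int {k : sphere (0 : Euc d) 1 → Euc d × Euc m → ℝ}
    (hk : Integrable (fun x : sphere (0 : Euc d) 1 × (Euc d × Euc m) => k x.1 x.2)
      ((sphμ d).prod (nuu d Ω))) :
    ∫ z in Ω, ∫ y : Euc d, ∫ ω, k ω (y, z) ∂(sphμ d)
      = ∫ ω, ∫ p, k ω p ∂(nuu d Ω) ∂(sphμ d) := by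
  rw [integral_integral_swap hk]
  have h := hk.integral_prod_right
  unfold nuu at h ⊢
  rw [integral_prod_symm _ h]

lemma exists_omega (hΩ : IsOpen Ω) (hb : Bornology.IsBounded Ω)
    {ρ₀ : Euc d → Euc m → ℝ} {v₀ : Euc d → Euc m → Euc d}
    (hρ₀ : ContinuousOn (fun p : Euc d × Euc m => ρ₀ p.1 p.2) (univ ×ˢ closure Ω))
    (hv₀ : ContinuousOn (fun p : Euc d × Euc m => v₀ p.1 p.2) (univ ×ˢ closure Ω))
    (hs : ∀ y : Euc d, 1 < ‖y‖ → ∀ z, ρ₀ y z = 0 ∧ v₀ y z = 0)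
    (hdata :
      0 < (∫ z in Ω, ∫ y : Euc d, ∫ ω : sphere (0 : Euc d) 1,
              exp ⟪(ω : Euc d), y⟫ * ρ₀ y z ∂(sphμ d))
          + ∫ z in Ω, ∫ y : Euc d, ∫ ω : sphere (0 : Euc d) 1,
              exp ⟪(ω : Euc d), y⟫ * (1 + ρ₀ y z) * ⟪v₀ y z, (ω : Euc d)⟫ ∂(sphμ d)) :
    ∃ ω : Euc d, ‖ω‖ = 1 ∧ 0 < (∫ p, exp ⟪ω, p.1⟫ * ρ₀ p.1 p.2 ∂nuu d Ω)
      + ∫ p, exp ⟪ω, p.1⟫ * (1 + ρ₀ p.1 p.2) * ⟪v₀ p.1 p.2, ω⟫ ∂nuu d Ω := by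
  have hr : ContinuousOn (fun q : XX d m => ρ₀ q.2.1 q.2.2) (SS d Ω) :=
    hρ₀.comp (f := fun q : XX d m => q.2) (by fun_prop) (fun q hq => hq.2)
  have hv : ContinuousOn (fun q : XX d m => v₀ q.2.1 q.2.2) (SS d Ω) :=
    hv₀.comp (f := fun q : XX d m => q.2) (by fun_prop) (fun q hq => hq.2)
  have i1 := int_val hΩ hb (f := fun q : XX d m => ρ₀ q.2.1 q.2.2) hr
    (fun q hq h => (hs _ (lt_of_le_of_lt (by linarith [mem_Ici.1 hq.1]) h) _).1) (t := 0) le_rfl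
  have i2 := int_val hΩ hb (f := fun q : XX d m => (1 + ρ₀ q.2.1 q.2.2) * ‖v₀ q.2.1 q.2.2‖)
    ((continuousOn_const.add hr).mul hv.norm)
    (fun q hq h => by
      simp [(hs q.2.1 (lt_of_le_of_lt (by linarith [mem_Ici.1 hq.1]) h) q.2.2).2]) (t := 0) le_rfl
  simp only at i1 i2
  have hmv : AEStronglyMeasurable (fun p : Euc d × Euc m => v₀ p.1 p.2) (nuu d Ω) := by
    rw [nuu_eq]
    exact (hv₀.mono (prod_mono le_rfl subset_closure)).aestronglyMeasurable
      (MeasurableSet.univ.prod hΩ.measurableSet)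
  have hme : Continuous (fun x : sphere (0 : Euc d) 1 × (Euc d × Euc m) =>
      exp ⟪(x.1 : Euc d), x.2.1⟫) := by fun_prop
  have hexp : ∀ (ω : sphere (0 : Euc d) 1) (y : Euc d), ‖y‖ ≤ 1 → ⟪(ω : Euc d), y⟫ ≤ 1 := by
    intro ω y hy
    refine (real_inner_le_norm _ _).trans ?_
    have : ‖(ω : Euc d)‖ = 1 := by simpa using ω.2
    rw [this]; linarith
  have k1 : Integrable (fun x : sphere (0 : Euc d) 1 × (Euc d × Euc m) =>
      exp ⟪(x.1 : Euc d), x.2.1⟫ * ρ₀ x.2.1 x.2.2) ((sphμ d).prod (nuu d Ω)) := by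
    refine Integrable.mono' ((i1.abs.const_mul (exp 1)).comp_snd (sphμ d))
      (hme.aestronglyMeasurable.mul i1.aestronglyMeasurable.comp_snd)
      (Filter.Eventually.of_forall fun x => ?_)
    rw [norm_mul, Real.norm_eq_abs, Real.norm_eq_abs, abs_of_pos (exp_pos _)]
    rcases le_or_gt ‖x.2.1‖ 1 with h | h
    · gcongr; exact hexp _ _ h
    · simp [(hs _ h x.2.2).1]
  have k2 : Integrable (fun x : sphere (0 : Euc d) 1 × (Euc d × Euc m) =>
      exp ⟪(x.1 : Euc d), x.2.1⟫ * (1 + ρ₀ x.2.1 x.2.2) * ⟪v₀ x.2.1 x.2.2, (x.1 : Euc d)⟫)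
      ((sphμ d).prod (nuu d Ω)) := by
    refine Integrable.mono' ((i2.abs.const_mul (exp 1)).comp_snd (sphμ d)) ?_
      (Filter.Eventually.of_forall fun x => ?_)
    · refine (hme.aestronglyMeasurable.mul (aestronglyMeasurable_const.add
        i1.aestronglyMeasurable.comp_snd)).mul ?_
      exact AEStronglyMeasurable.inner (hmv.comp_snd) (by fun_prop)
    · rw [norm_mul, norm_mul, Real.norm_eq_abs, Real.norm_eq_abs, abs_of_pos (exp_pos _), abs_mul,
        abs_norm, mul_assoc]
      rcases le_or_gt ‖x.2.1‖ 1 with h | h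
      · have hn : ‖(x.1 : Euc d)‖ = 1 := by simpa using x.1.2
        have h2 := norm_inner_le_norm (𝕜 := ℝ) (v₀ x.2.1 x.2.2) (x.1 : Euc d)
        rw [hn, mul_one] at h2
        gcongr
        exact hexp _ _ h
      · simp [(hs _ h x.2.2).2]
  rw [swap_int (k := fun ω p => exp ⟪(ω : Euc d), p.1⟫ * ρ₀ p.1 p.2) k1,
    swap_int (k := fun ω p => exp ⟪(ω : Euc d), p.1⟫ * (1 + ρ₀ p.1 p.2) * ⟪v₀ p.1 p.2, (ω : Euc d)⟫) k2,
    ← integral_add k1.integral_prod_left k2.integral_prod_left] at hdata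
  by_contra hcon
  push Not at hcon
  refine absurd hdata (not_lt.2 (integral_nonpos fun ω => ?_))
  exact hcon ω (by simpa using ω.2)

lemma energy (hd1 : 1 ≤ d) (hd3 : d ≤ 3) (hΩ : IsOpen Ω) (hb : Bornology.IsBounded Ω)
    {ω : Euc d} (hω : ‖ω‖ = 1) {r h : Euc d × Euc m → ℝ} {t : ℝ} (ht : 0 < t)
    (hr : Integrable (fun p => exp ⟪ω, p.1⟫ * (r p - 1)) (nuu d Ω))
    (hh : Integrable (fun p => exp ⟪ω, p.1⟫ * h p) (nuu d Ω))
    (hle : ∀ p, p.2 ∈ Ω → (r p ^ 2 - 1) / 2 ≤ h p)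
    (hsupp : ∀ p, p.2 ∈ Ω → 1 + t < ‖p.1‖ → r p = 1) {W : ℝ}
    (hW : W = volume.real Ω * (100 * exp 1) + 1) :
    (∫ p, exp ⟪ω, p.1⟫ * (r p - 1) ∂nuu d Ω)
      + (∫ p, exp ⟪ω, p.1⟫ * (r p - 1) ∂nuu d Ω) ^ 2 / (2 * (W * (1 + t) * exp t))
      ≤ ∫ p, exp ⟪ω, p.1⟫ * h p ∂nuu d Ω := by
  set F := ∫ p, exp ⟪ω, p.1⟫ * (r p - 1) ∂nuu d Ω with hF
  set V' := W * (1 + t) * exp t with hV'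
  have hWpos : 0 < W := by rw [hW]; positivity
  have hVpos : 0 < V' := by positivity
  set χ : Euc d × Euc m → ℝ := fun p =>
    (closedBall (0 : Euc d) (1 + t)).indicator (fun y => exp ⟪ω, y⟫) p.1 * 1 with hχ
  have hi : Integrable ((closedBall (0 : Euc d) (1 + t)).indicator (fun y => exp ⟪ω, y⟫)) := by
    rw [integrable_indicator_iff measurableSet_closedBall]
    exact ContinuousOn.integrableOn_compact (isCompact_closedBall _ _) (by fun_prop)
  have hfin : volume Ω < ⊤ := hb.measure_lt_top
  have hχi : Integrable χ (nuu d Ω) := by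
    have h1 : Integrable (fun _ : Euc m => (1 : ℝ)) (volume.restrict Ω) :=
      integrableOn_const hfin.ne
    exact hi.mul_prod h1
  have hχv : ∫ p, χ p ∂nuu d Ω ≤ V' := by
    have e1 : ∫ p, χ p ∂nuu d Ω = (∫ y in closedBall (0 : Euc d) (1 + t), exp ⟪ω, y⟫) * volume.real Ω := by
      have := integral_prod_mul (μ := (volume : Measure (Euc d))) (ν := volume.restrict Ω)
        ((closedBall (0 : Euc d) (1 + t)).indicator (fun y => exp ⟪ω, y⟫)) (fun _ : Euc m => (1 : ℝ))
      rw [integral_indicator measurableSet_closedBall] at this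
      simpa [hχ, nuu] using this
    have e2 := vol_bound hd1 hd3 (R := 1 + t) (by linarith) hω
    rw [e1, hV', hW]
    calc _ ≤ (100 * (1 + t) * exp (1 + t)) * volume.real Ω := by gcongr
      _ = (volume.real Ω * (100 * exp 1)) * (1 + t) * exp t := by rw [exp_add]; ring
      _ ≤ _ := by gcongr; linarith
  set a := F / V' with ha
  have hIntg : ∫ p, ((1 + a) * (exp ⟪ω, p.1⟫ * (r p - 1)) - a ^ 2 / 2 * χ p) ∂nuu d Ω
      ≤ ∫ p, exp ⟪ω, p.1⟫ * h p ∂nuu d Ω := by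
    refine integral_mono_ae ((hr.const_mul _).sub (hχi.const_mul _)) hh (nuu_ae hΩ fun p hp => ?_)
    have h1 := hle p hp
    have h2 := exp_pos ⟪ω, p.1⟫
    simp only [hχ]
    rcases le_or_gt ‖p.1‖ (1 + t) with hn | hn
    · rw [indicator_of_mem (by simpa using hn)]
      have h3 : (1 + a) * (r p - 1) - a ^ 2 / 2 ≤ h p := by nlinarith [sq_nonneg (r p - 1 - a)]
      nlinarith
    · rw [indicator_of_notMem (by simpa using hn)]
      have h3 := hsupp p hp hn
      rw [h3] at h1 ⊢
      norm_num at h1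
      have := mul_nonneg h2.le h1
      simpa using this
  rw [integral_sub (hr.const_mul _) (hχi.const_mul _), integral_const_mul, integral_const_mul,
    ← hF] at hIntg
  have h5 : a ^ 2 / 2 * ∫ p, χ p ∂nuu d Ω ≤ a ^ 2 / 2 * V' := by gcongr
  have h6 : F + F ^ 2 / (2 * V') = (1 + a) * F - a ^ 2 / 2 * V' := by
    rw [ha]; field_simp; ring
  linarith

end main1

section core
variable {d m : ℕ} {Ω : Set (Euc m)}

lemma blowup_core (hd1 : 1 ≤ d) (hd3 : d ≤ 3) (hΩ : IsOpen Ω) (hb : Bornology.IsBounded Ω)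
    {ω : Euc d} (hω : ‖ω‖ = 1) {r : XX d m → ℝ} {v : Fin d → XX d m → ℝ} {w : Fin m → XX d m → ℝ}
    (hr : ContDiffOn ℝ 1 r (SS d Ω)) (hv : ∀ i, ContDiffOn ℝ 1 (v i) (SS d Ω))
    (hw : ∀ k, ContDiffOn ℝ 1 (w k) (SS d Ω)) (hpos : ∀ q ∈ SS d Ω, 0 < r q)
    (sr : Supp Ω (fun q => r q - 1)) (sv : ∀ i, Supp Ω (v i)) (sw : ∀ k, Supp Ω (w k))
    (hfr : ∀ k t y z, 0 < t → z ∈ frontier Ω → w k (t, y, z) = 0)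
    (hmass : ∀ q ∈ UU d Ω, fderiv ℝ r q (1, 0, 0)
      + ∑ i, fderiv ℝ (fun q => r q * v i q) q (0, EuclideanSpace.single i 1, 0)
      + ∑ k, fderiv ℝ (fun q => r q * w k q) q (0, 0, EuclideanSpace.single k 1) = 0)
    (hmom : ∀ q ∈ UU d Ω, ∀ j, fderiv ℝ (fun q => r q * v j q) q (1, 0, 0)
      + ∑ i, fderiv ℝ (fun q => r q * v i q * v j q) q (0, EuclideanSpace.single i 1, 0)
      + ∑ k, fderiv ℝ (fun q => r q * v j q * w k q) q (0, 0, EuclideanSpace.single k 1)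
      + fderiv ℝ (fun q => r q ^ 2 / 2) q (0, EuclideanSpace.single j 1, 0) = 0)
    (h0 : 0 < (∫ p, exp ⟪ω, p.1⟫ * (r (0, p) - 1) ∂nuu d Ω)
      + ∫ p, exp ⟪ω, p.1⟫ * ∑ i, ω i * (r (0, p) * v i (0, p)) ∂nuu d Ω) : False := by
  have c1 : ∀ i, ContDiffOn ℝ 1 (fun q => r q * v i q) (SS d Ω) := fun i => hr.mul (hv i)
  have c2 : ∀ k, ContDiffOn ℝ 1 (fun q => r q * w k q) (SS d Ω) := fun k => hr.mul (hw k)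
  have c3 : ∀ i j, ContDiffOn ℝ 1 (fun q => r q * v i q * v j q) (SS d Ω) :=
    fun i j => (c1 i).mul (hv j)
  have c4 : ∀ k j, ContDiffOn ℝ 1 (fun q => r q * v j q * w k q) (SS d Ω) :=
    fun k j => (c1 j).mul (hw k)
  have c5 : ContDiffOn ℝ 1 (fun q => r q ^ 2 / 2) (SS d Ω) := (hr.pow 2).div_const 2
  have cl : ∀ f : Fin d → XX d m → ℝ, (∀ j, ContDiffOn ℝ 1 (f j) (SS d Ω)) →
      ContDiffOn ℝ 1 (fun q => ∑ j, ω j * f j q) (SS d Ω) := fun f hf =>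
    ContDiffOn.sum fun j _ => contDiffOn_const.mul (hf j)
  let A2 : XX d m → ℝ := fun q => ∑ j, ω j * (r q * v j q)
  let B2 : Fin d → XX d m → ℝ := fun i q =>
    (∑ j, ω j * (r q * v i q * v j q)) + (ω i * (r q ^ 2 / 2) - ω i * (1 / 2))
  let C2 : Fin m → XX d m → ℝ := fun k q => ∑ j, ω j * (r q * v j q * w k q)
  have cA : ContDiffOn ℝ 1 A2 (SS d Ω) := cl _ c1
  have cB : ∀ i, ContDiffOn ℝ 1 (B2 i) (SS d Ω) := fun i =>
    (cl _ (c3 i)).add ((contDiffOn_const.mul c5).sub contDiffOn_const)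
  have cC : ∀ k, ContDiffOn ℝ 1 (C2 k) (SS d Ω) := fun k => cl _ (c4 k)
  have sA : Supp Ω A2 := fun q hq h => by simp [A2, sv _ q hq h]
  have sB : ∀ i, Supp Ω (B2 i) := fun i q hq h => by
    have h1 : r q = 1 := by have := sr q hq h; linarith
    simp [B2, sv _ q hq h, h1]
  have sC : ∀ k, Supp Ω (C2 k) := fun k q hq h => by simp [C2, sv _ q hq h]
  have s1 : ∀ i, Supp Ω (fun q => r q * v i q) := fun i q hq h => by simp [sv _ q hq h]
  have s2 : ∀ k, Supp Ω (fun q => r q * w k q) := fun i q hq h => by simp [sw _ q hq h]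
  have hA1 : ContDiffOn ℝ 1 (fun q => r q - 1) (SS d Ω) := hr.sub contDiffOn_const
  set F : ℝ → ℝ := fun t => ∫ p, exp ⟪ω, p.1⟫ * (r (t, p) - 1) ∂nuu d Ω with hF
  set G : ℝ → ℝ := fun t => ∫ p, exp ⟪ω, p.1⟫ * ∑ i, ω i * (r (t, p) * v i (t, p)) ∂nuu d Ω with hG
  set H : ℝ → ℝ := fun t => ∫ p, exp ⟪ω, p.1⟫ * ∑ i, ω i * B2 i (t, p) ∂nuu d Ω with hH
  have dF : ∀ t, 0 < t → HasDerivAt F (G t) t := fun t ht =>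
    conserve hΩ hb ω hA1 c1 c2 sr s1 s2
      (fun k t y z ht hz => by simp [hfr k t y z ht hz])
      (fun q hq => by rw [fderiv_sub_const]; exact hmass q hq) ht
  have dG : ∀ t, 0 < t → HasDerivAt G (H t) t := fun t ht =>
    conserve hΩ hb ω cA cB cC sA sB sC
      (fun k t y z ht hz => by simp [C2, hfr k t y z ht hz])
      (fun q hq => by
        have e1 := fderiv_lin hΩ c1 (fun j => ω j) hq (1, 0, 0)
        have e2 : ∀ i, fderiv ℝ (B2 i) q (0, EuclideanSpace.single i 1, 0)
            = ∑ j, ω j * fderiv ℝ (fun q => r q * v i q * v j q) q (0, EuclideanSpace.single i 1, 0)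
              + ω i * fderiv ℝ (fun q => r q ^ 2 / 2) q (0, EuclideanSpace.single i 1, 0) := by
          intro i
          have a1 := diffAt hΩ (cl _ (c3 i)) hq
          have a2 := diffAt hΩ c5 hq
          have a3 : HasFDerivAt (B2 i) _ q :=
            a1.hasFDerivAt.add ((a2.hasFDerivAt.const_mul (ω i)).sub_const (ω i * (1 / 2)))
          rw [a3.fderiv, ← fderiv_lin hΩ (c3 i) (fun j => ω j) hq]
          simp
        have e3 : ∀ k, fderiv ℝ (C2 k) q (0, 0, EuclideanSpace.single k 1)
            = ∑ j, ω j * fderiv ℝ (fun q => r q * v j q * w k q) q (0, 0, EuclideanSpace.single k 1) :=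
          fun k => fderiv_lin hΩ (c4 k) (fun j => ω j) hq _
        have e4 : ∑ j, ω j * (fderiv ℝ (fun q => r q * v j q) q (1, 0, 0)
            + ∑ i, fderiv ℝ (fun q => r q * v i q * v j q) q (0, EuclideanSpace.single i 1, 0)
            + ∑ k, fderiv ℝ (fun q => r q * v j q * w k q) q (0, 0, EuclideanSpace.single k 1)
            + fderiv ℝ (fun q => r q ^ 2 / 2) q (0, EuclideanSpace.single j 1, 0)) = 0 :=
          Finset.sum_eq_zero fun j _ => by rw [hmom q hq j, mul_zero]
        simp only [mul_add, Finset.sum_add_distrib, Finset.mul_sum] at e4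
        rw [show fderiv ℝ A2 q (1, 0, 0) = _ from e1, Finset.sum_congr rfl fun i _ => e2 i,
          Finset.sum_congr rfl fun k _ => e3 k, Finset.sum_add_distrib, Finset.sum_comm,
          Finset.sum_comm (f := fun k j => ω j * fderiv ℝ (fun q => r q * v j q * w k q) q
            (0, 0, EuclideanSpace.single k 1))]
        linarith) ht
  have hec : ContinuousOn (fun q : XX d m => exp ⟪ω, q.2.1⟫) (SS d Ω) := by fun_prop
  have sE : ∀ {f : XX d m → ℝ}, Supp Ω f → Supp Ω (fun q => exp ⟪ω, q.2.1⟫ * f q) :=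
    fun hf q hq h => by simp [hf q hq h]
  have cF : ContinuousOn F (Ici 0) := cont_int hΩ hb (hec.mul hA1.continuousOn) (sE sr)
  have cG : ContinuousOn G (Ici 0) := cont_int hΩ hb (hec.mul cA.continuousOn) (sE sA)
  have hω2 : ∑ i, ω i ^ 2 = 1 := by
    have := EuclideanSpace.real_norm_sq_eq ω
    rw [hω] at this; linarith
  set W := volume.real Ω * (100 * exp 1) + 1 with hW
  have hWpos : 0 < W := by positivity
  have sBB : Supp Ω (fun q => ∑ i, ω i * B2 i q) := fun q hq h => by
    simp [sB _ q hq h]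
  have hE : ∀ t, 0 < t → F t + F t ^ 2 / (2 * (W * (1 + t) * exp t)) ≤ H t := by
    intro t ht
    refine energy hd1 hd3 hΩ hb hω (r := fun p => r (t, p)) (h := fun p => ∑ i, ω i * B2 i (t, p)) ht
      (int_val hΩ hb (hec.mul hA1.continuousOn) (sE sr) ht.le)
      (int_val hΩ hb (hec.mul (cl _ cB).continuousOn) (sE sBB) ht.le) ?_ ?_ hW
    · intro p hp
      have hq : ((t, p) : XX d m) ∈ SS d Ω := ⟨ht.le, mem_univ _, subset_closure hp⟩
      have e : ∑ i, ω i * B2 i (t, p)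
          = r (t, p) * (∑ i, ω i * v i (t, p)) ^ 2 + (r (t, p) ^ 2 - 1) / 2 := by
        have : ∀ i, ω i * B2 i (t, p) = r (t, p) * ((ω i * v i (t, p)) * ∑ j, ω j * v j (t, p))
            + ω i ^ 2 * ((r (t, p) ^ 2 - 1) / 2) := by
          intro i
          have e5 : ∑ j, ω j * (r (t, p) * v i (t, p) * v j (t, p))
              = r (t, p) * v i (t, p) * ∑ j, ω j * v j (t, p) := by
            rw [Finset.mul_sum]; exact Finset.sum_congr rfl fun j _ => by ring
          simp only [B2, e5]; ring
        rw [Finset.sum_congr rfl fun i _ => this i, Finset.sum_add_distrib, ← Finset.sum_mul,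
          ← Finset.mul_sum, ← Finset.sum_mul, hω2]
        ring
      simp only [e]
      have := mul_nonneg (hpos _ hq).le (sq_nonneg (∑ i, ω i * v i (t, p)))
      linarith
    · intro p hp hn
      have := sr (t, p) ⟨ht.le, mem_univ _, subset_closure hp⟩ hn
      simp only at this
      linarith
  have hexp : ∀ t : ℝ, HasDerivAt (fun t => exp (-t)) (-exp (-t)) t := fun t => by
    simpa using (hasDerivAt_neg t).exp
  have hce : ContinuousOn (fun t : ℝ => exp (-t)) (Ici 0) := by fun_prop
  refine ode_blowup (f := fun t => F t * exp (-t)) (g := fun t => (G t - F t) * exp (-t))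
    (h := fun t => (H t - 2 * G t + F t) * exp (-t)) (κ := 1 / (2 * W)) (by positivity)
    (cF.mul hce) ((cG.sub cF).mul hce) ?_ ?_ ?_ ?_
  · intro t ht
    refine HasDerivAt.congr_deriv ((dF t ht).mul (hexp t)) ?_
    ring
  · intro t ht
    have h1 : HasDerivAt (fun t => G t - F t) (H t - G t) t := (dG t ht).sub (dF t ht)
    refine HasDerivAt.congr_deriv (h1.mul (hexp t)) ?_
    ring
  · intro t ht
    have h1 := mul_le_mul_of_nonneg_right (hE t ht) (exp_pos (-t)).le
    have h2 : (F t + F t ^ 2 / (2 * (W * (1 + t) * exp t))) * exp (-t)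
        = F t * exp (-t) + 1 / (2 * W) * (F t * exp (-t)) ^ 2 / (1 + t) := by
      have : 1 + t ≠ 0 := by linarith
      rw [exp_neg]
      field_simp
    rw [h2] at h1
    linarith
  · simp only [neg_zero, exp_zero, mul_one]
    linarith

end core

/-- Blow-up for the compressible Navier–Stokes system without horizontal viscosity on
`ℝᵈ × Ω`, `Ω ⊆ ℝ^{n-d}` a bounded domain, with pressure `p(ρ) = ρ²/2`:
`∂ₜρ + ∇_y⋅(ρv) + ∇_z⋅(ρw) = 0`,
`∂ₜ(ρv) + ∇_y⋅(ρ v⊗v) + ∇_z⋅(ρ v⊗w) + ∇_y p = 0`,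
`∂ₜ(ρw) + ∇_z⋅(ρ w⊗w) + ∇_y⋅(ρ w⊗v) + ∇_z p = λ Δ_z w + μ ∇_z(∇_z⋅w)`,
with Dirichlet boundary condition `w = 0` on `∂Ω`.  If
`∫_Ω∫_{ℝᵈ}∫_{S^{d-1}} e^{ω·y} ρ₀ + ∫_Ω∫_{ℝᵈ}∫_{S^{d-1}} e^{ω·y}(1+ρ₀)(v₀·ω) > 0`,
then the classical solution blows up in finite time. -/
theorem navier_stokes_no_horizontal_viscosity_blowup
    (n d : ℕ) (hd1 : 1 ≤ d) (hd3 : d ≤ 3) (hdn : d < n)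
    (Ω : Set (Euc (n - d))) (hΩopen : IsOpen Ω) (hΩbdd : Bornology.IsBounded Ω)
    (hΩconn : IsConnected Ω)
    (lam mu : ℝ)
    (T : ℝ≥0∞) (hT : 0 < T)
    (ρ : ℝ → Euc d → Euc (n - d) → ℝ)
    (v : ℝ → Euc d → Euc (n - d) → Euc d)
    (w : ℝ → Euc d → Euc (n - d) → Euc (n - d))
    (ρ₀ : Euc d → Euc (n - d) → ℝ)
    (v₀ : Euc d → Euc (n - d) → Euc d)
    (w₀ : Euc d → Euc (n - d) → Euc (n - d))
    -- smooth initial data, supported in `{|y| ≤ 1}`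
    (hρ₀ : ContDiffOn ℝ (⊤ : ℕ∞) (fun p : Euc d × Euc (n - d) => ρ₀ p.1 p.2) (univ ×ˢ closure Ω))
    (hv₀ : ContDiffOn ℝ (⊤ : ℕ∞) (fun p : Euc d × Euc (n - d) => v₀ p.1 p.2) (univ ×ˢ closure Ω))
    (hw₀ : ContDiffOn ℝ (⊤ : ℕ∞) (fun p : Euc d × Euc (n - d) => w₀ p.1 p.2) (univ ×ˢ closure Ω))
    (hdata_supp : ∀ y : Euc d, 1 < ‖y‖ → ∀ z,
      ρ₀ y z = 0 ∧ v₀ y z = 0 ∧ w₀ y z = 0)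
    (hinit : ∀ y, ∀ z ∈ closure Ω,
      ρ 0 y z = 1 + ρ₀ y z ∧ v 0 y z = v₀ y z ∧ w 0 y z = w₀ y z)
    -- classical solution: `C¹` in all variables, `C²` in `z` for `w`
    (hregρ : ContDiffOn ℝ 1 (fun p : ℝ × Euc d × Euc (n - d) => ρ p.1 p.2.1 p.2.2)
      (timeSet T ×ˢ univ ×ˢ closure Ω))
    (hregv : ContDiffOn ℝ 1 (fun p : ℝ × Euc d × Euc (n - d) => v p.1 p.2.1 p.2.2)
      (timeSet T ×ˢ univ ×ˢ closure Ω))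
    (hregw : ContDiffOn ℝ 1 (fun p : ℝ × Euc d × Euc (n - d) => w p.1 p.2.1 p.2.2)
      (timeSet T ×ˢ univ ×ˢ closure Ω))
    (hregw2 : ∀ t ∈ timeSet T, ∀ y, ContDiffOn ℝ 2 (fun z => w t y z) Ω)
    (hρpos : ∀ t ∈ timeSet T, ∀ y, ∀ z ∈ closure Ω, 0 < ρ t y z)
    -- the equations, pointwise on `[0,T) × ℝᵈ × Ω`
    (hmass : ∀ t ∈ timeSet T, ∀ y, ∀ z ∈ Ω,
      derivWithin (fun s => ρ s y z) (timeSet T) t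
        + (∑ i, pdv i (fun y' => ρ t y' z * v t y' z i) y)
        + (∑ k, pdv k (fun z' => ρ t y z' * w t y z' k) z) = 0)
    (hmomy : ∀ t ∈ timeSet T, ∀ y, ∀ z ∈ Ω, ∀ j : Fin d,
      derivWithin (fun s => ρ s y z * v s y z j) (timeSet T) t
        + (∑ i, pdv i (fun y' => ρ t y' z * v t y' z i * v t y' z j) y)
        + (∑ k, pdv k (fun z' => ρ t y z' * v t y z' j * w t y z' k) z)
        + pdv j (fun y' => ρ t y' z ^ 2 / 2) y = 0)
    (hmomz : ∀ t ∈ timeSet T, ∀ y, ∀ z ∈ Ω, ∀ l : Fin (n - d),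
      derivWithin (fun s => ρ s y z * w s y z l) (timeSet T) t
        + (∑ k, pdv k (fun z' => ρ t y z' * w t y z' k * w t y z' l) z)
        + (∑ i, pdv i (fun y' => ρ t y' z * w t y' z l * v t y' z i) y)
        + pdv l (fun z' => ρ t y z' ^ 2 / 2) z
        = lam * (∑ k, pdv k (fun z' => pdv k (fun z'' => w t y z'' l) z') z)
          + mu * pdv l (fun z' => ∑ k, pdv k (fun z'' => w t y z'' k) z') z)
    -- Dirichlet boundary condition
    (hbc : ∀ t ∈ timeSet T, ∀ y, ∀ z ∈ frontier Ω, w t y z = 0)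
    -- finite propagation speed of the support in `y`
    (hsupp : ∀ t ∈ timeSet T, ∀ y : Euc d, 1 + t < ‖y‖ → ∀ z ∈ closure Ω,
      ρ t y z = 1 ∧ v t y z = 0 ∧ w t y z = 0)
    -- sign condition on the initial data
    (hdata :
      0 < (∫ z in Ω, ∫ y : Euc d, ∫ ω : sphere (0 : Euc d) 1,
              exp ⟪(ω : Euc d), y⟫ * ρ₀ y z ∂(sphμ d))
          + ∫ z in Ω, ∫ y : Euc d, ∫ ω : sphere (0 : Euc d) 1,
              exp ⟪(ω : Euc d), y⟫ * (1 + ρ₀ y z) * ⟪v₀ y z, (ω : Euc d)⟫ ∂(sphμ d)) :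
    T < ⊤ := by
  by_contra hcon
  have hTtop : T = ⊤ := not_lt_top_iff.1 hcon
  subst hTtop
  have hts : timeSet ⊤ = Ici 0 := by
    ext t; simp [timeSet]
  simp only [hts] at *
  obtain ⟨ω, hω, hpos⟩ := exists_omega hΩopen hΩbdd hρ₀.continuousOn hv₀.continuousOn
    (fun y hy z => ⟨(hdata_supp y hy z).1, (hdata_supp y hy z).2.1⟩) hdata
  have hr : ContDiffOn ℝ 1 (fun q : XX d (n - d) => ρ q.1 q.2.1 q.2.2) (SS d Ω) := hregρ
  have hv : ∀ i, ContDiffOn ℝ 1 (fun q : XX d (n - d) => v q.1 q.2.1 q.2.2 i) (SS d Ω) :=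
    fun i => contDiffOn_euclidean.1 hregv i
  have hw : ∀ k, ContDiffOn ℝ 1 (fun q : XX d (n - d) => w q.1 q.2.1 q.2.2 k) (SS d Ω) :=
    fun i => contDiffOn_euclidean.1 hregw i
  refine blowup_core hd1 hd3 hΩopen hΩbdd hω hr hv hw
    (fun q hq => hρpos _ hq.1 _ _ hq.2.2)
    (fun q hq h => by simp [(hsupp _ hq.1 _ h _ hq.2.2).1])
    (fun i q hq h => by simp [(hsupp _ hq.1 _ h _ hq.2.2).2.1])
    (fun i q hq h => by simp [(hsupp _ hq.1 _ h _ hq.2.2).2.2])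
    (fun k t y z ht hz => by simp [hbc t ht.le y z hz]) ?_ ?_ ?_
  · rintro ⟨t, y, z⟩ ⟨ht, -, hz⟩
    have h := hmass t (mem_Ici.2 (le_of_lt (mem_Ioi.1 ht))) y z hz
    replace ht : 0 < t := ht
    replace hz : z ∈ Ω := hz
    have e1 := pdv_t (y := y) hΩopen hr ht hz
    have e2 := fun i => pdv_y (y := y) hΩopen (hr.mul (hv i)) ht hz i
    have e3 := fun k => pdv_z (y := y) hΩopen (hr.mul (hw k)) ht hz k
    refine Eq.trans (congrArg₂ (· + ·) (congrArg₂ (· + ·) e1.symm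
      (Finset.sum_congr rfl fun i _ => (e2 i).symm))
      (Finset.sum_congr rfl fun k _ => (e3 k).symm)) h
  · rintro ⟨t, y, z⟩ ⟨ht, -, hz⟩ j
    have h := hmomy t (mem_Ici.2 (le_of_lt (mem_Ioi.1 ht))) y z hz j
    replace ht : 0 < t := ht
    replace hz : z ∈ Ω := hz
    have e1 := pdv_t (y := y) hΩopen (hr.mul (hv j)) ht hz
    have e2 := fun i => pdv_y (y := y) hΩopen ((hr.mul (hv i)).mul (hv j)) ht hz i
    have e3 := fun k => pdv_z (y := y) hΩopen ((hr.mul (hv j)).mul (hw k)) ht hz k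
    have e4 := pdv_y (y := y) hΩopen ((hr.pow 2).div_const 2) ht hz j
    refine Eq.trans (congrArg₂ (· + ·) (congrArg₂ (· + ·) (congrArg₂ (· + ·) e1.symm
      (Finset.sum_congr rfl fun i _ => (e2 i).symm))
      (Finset.sum_congr rfl fun k _ => (e3 k).symm)) e4.symm) h
  · refine lt_of_lt_of_eq hpos ?_
    congr 1
    · refine integral_congr_ae (nuu_ae hΩopen fun p hp => ?_)
      simp only [(hinit p.1 p.2 (subset_closure hp)).1]
      ring
    · refine integral_congr_ae (nuu_ae hΩopen fun p hp => ?_)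
      simp only [(hinit p.1 p.2 (subset_closure hp)).1, (hinit p.1 p.2 (subset_closure hp)).2.1]
      rw [mul_assoc]
      congr 1
      rw [PiLp.inner_apply, Finset.mul_sum]
      refine Finset.sum_congr rfl fun i _ => ?_
      simp
      ring

end
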